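/- Let G be a 2-connected finite simple graph. Then G has spaghetti treewidth equal to two if and only if G has no minor isomorphic to K_4 or to D_3. -/

import Mathlib

open SimpleGraph

/-- The cycle graph on `ZMod n` (for `3 ≤ n` this is a cycle of length `n`). -/
def cycGraph (n : ℕ) : SimpleGraph (ZMod n) :=
  SimpleGraph.fromRel (fun x y => x = y + 1)

/-- The set `s` of nodes induces a path in the graph `H`. -/
def IsPathSet {ι : Type} (H : SimpleGraph ι) (s : Set ι) : Prop :=
  (H.induce s).Connected ∧ ∀ x ∈ s, {y | y ∈ s ∧ H.Adj x y}.ncard ≤ 2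

/-- The set `s` of nodes induces a directed path in `H` with respect to the
orientation `o` of the edges of `H`. -/
def IsDirPathSet {ι : Type} (H : SimpleGraph ι) (o : ι → ι → Prop) (s : Set ι) : Prop :=
  IsPathSet H s ∧ (∀ x ∈ s, {y | y ∈ s ∧ o x y}.ncard ≤ 1) ∧
    (∀ x ∈ s, {y | y ∈ s ∧ o y x}.ncard ≤ 1)

/-- A tree decomposition of a finite simple graph `G`. -/
structure TreeDecomp {V : Type} (G : SimpleGraph V) where
  ι : Type
  finι : Finite ι
  tree : SimpleGraph ι
  isTree : tree.IsTree
  bag : ι → Set V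
  bag_cover : ∀ v : V, ∃ x, v ∈ bag x
  bag_edge : ∀ ⦃u v : V⦄, G.Adj u v → ∃ x, u ∈ bag x ∧ v ∈ bag x
  bag_conn : ∀ v : V, (tree.induce {x | v ∈ bag x}).Connected

/-- A spaghetti tree decomposition: for every vertex `v` of `G`, the nodes whose
bags contain `v` induce a path in the tree. -/
structure SpaghettiTD {V : Type} (G : SimpleGraph V) extends TreeDecomp G where
  bag_path : ∀ v : V, IsPathSet tree {x | v ∈ bag x}

/-- A directed spaghetti tree decomposition: the tree edges are oriented, and for
every vertex `v` of `G` the nodes whose bags contain `v` induce a directed path. -/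
structure DirSpaghettiTD {V : Type} (G : SimpleGraph V) extends TreeDecomp G where
  orient : ι → ι → Prop
  orient_iff : ∀ x y : ι, tree.Adj x y ↔ (orient x y ∨ orient y x)
  orient_asymm : ∀ x y : ι, orient x y → ¬ orient y x
  bag_dirpath : ∀ v : V, IsDirPathSet tree orient {x | v ∈ bag x}

/-- A special tree decomposition: the tree is rooted, and for every vertex `v` of
`G` the nodes whose bags contain `v` induce a vertical path, i.e. a directed path
with respect to the orientation of every tree edge towards the root. -/
structure SpecialTD {V : Type} (G : SimpleGraph V) extends TreeDecomp G where
  root : ι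
  bag_vertical : ∀ v : V,
    IsDirPathSet tree (fun x y => tree.Adj x y ∧ tree.dist y root < tree.dist x root)
      {x | v ∈ bag x}

/-- A path decomposition of a finite simple graph `G`. -/
structure PathDecomp {V : Type} (G : SimpleGraph V) where
  m : ℕ
  hm : 0 < m
  bag : Fin m → Set V
  bag_cover : ∀ v : V, ∃ i, v ∈ bag i
  bag_edge : ∀ ⦃u v : V⦄, G.Adj u v → ∃ i, u ∈ bag i ∧ v ∈ bag i
  bag_convex : ∀ (v : V) (i j k : Fin m), i ≤ j → j ≤ k → v ∈ bag i → v ∈ bag k → v ∈ bag j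

/-- Treewidth: minimal width of a tree decomposition. -/
noncomputable def treewidth {V : Type} (G : SimpleGraph V) : ℕ :=
  sInf {k | ∃ td : TreeDecomp G, ∀ x, (td.bag x).ncard ≤ k + 1}

/-- Spaghetti treewidth: minimal width of a spaghetti tree decomposition. -/
noncomputable def sptw {V : Type} (G : SimpleGraph V) : ℕ :=
  sInf {k | ∃ td : SpaghettiTD G, ∀ x, (td.bag x).ncard ≤ k + 1}

/-- Directed spaghetti treewidth: minimal width of a directed spaghetti tree
decomposition. -/
noncomputable def dptw {V : Type} (G : SimpleGraph V) : ℕ :=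
  sInf {k | ∃ td : DirSpaghettiTD G, ∀ x, (td.bag x).ncard ≤ k + 1}

/-- Special treewidth: minimal width of a special tree decomposition. -/
noncomputable def spctw {V : Type} (G : SimpleGraph V) : ℕ :=
  sInf {k | ∃ td : SpecialTD G, ∀ x, (td.bag x).ncard ≤ k + 1}

/-- Pathwidth: minimal width of a path decomposition. -/
noncomputable def pw {V : Type} (G : SimpleGraph V) : ℕ :=
  sInf {k | ∃ pd : PathDecomp G, ∀ i, (pd.bag i).ncard ≤ k + 1}

/-- A graph is chordal iff it has no induced (i.e. chordless) cycle of length at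
least four. -/
def IsChordal {V : Type} (G : SimpleGraph V) : Prop :=
  ∀ (S : Set V) (n : ℕ), 4 ≤ n → ¬ Nonempty ((G.induce S) ≃g cycGraph n)

/-- A graph is strongly chordal if it is chordal and every even cycle of length at
least six has an odd chord: a chord splitting the cycle into two odd paths of
length at least three. -/
def IsStronglyChordal {V : Type} (G : SimpleGraph V) : Prop :=
  IsChordal G ∧ ∀ n : ℕ, 6 ≤ n → Even n → ∀ f : ZMod n → V,
    Function.Injective f → (∀ i : ZMod n, G.Adj (f i) (f (i + 1))) →
      ∃ (i : ZMod n) (d : ℕ), Odd d ∧ 3 ≤ d ∧ d + 3 ≤ n ∧ G.Adj (f i) (f (i + (d : ZMod n)))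

/-- Strongly chordal treewidth: the minimum of `ω(H) - 1` over all strongly chordal
supergraphs `H` of `G` (on the same vertex set; here `ω(H) ≤ k + 1` is expressed as
`H.CliqueFree (k + 2)`). -/
noncomputable def sctw {V : Type} (G : SimpleGraph V) : ℕ :=
  sInf {k | ∃ H : SimpleGraph V, G ≤ H ∧ IsStronglyChordal H ∧ H.CliqueFree (k + 2)}

/-- `H` is a minor of `G`: there is a family of nonempty, pairwise disjoint,
connected branch sets in `G`, one for each vertex of `H`, such that every edge of
`H` is realized by an edge of `G` between the corresponding branch sets. -/
def IsMinorOf {W V : Type} (H : SimpleGraph W) (G : SimpleGraph V) : Prop :=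
  ∃ f : W → Set V,
    (∀ w, (f w).Nonempty) ∧ (∀ w, (G.induce (f w)).Connected) ∧
    (Pairwise fun w w' => Disjoint (f w) (f w')) ∧
    ∀ ⦃w w'⦄, H.Adj w w' → ∃ u ∈ f w, ∃ v ∈ f w', G.Adj u v

/-- The complete graph on four vertices. -/
def K4 : SimpleGraph (Fin 4) := ⊤

/-- `D₃`: two vertices (`0` and `1`) joined by three internally vertex-disjoint
paths of length three. -/
def D3 : SimpleGraph (Fin 8) := SimpleGraph.fromRel (fun x y =>
  (x = 0 ∧ y = 2) ∨ (x = 2 ∧ y = 3) ∨ (x = 3 ∧ y = 1) ∨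
  (x = 0 ∧ y = 4) ∨ (x = 4 ∧ y = 5) ∨ (x = 5 ∧ y = 1) ∨
  (x = 0 ∧ y = 6) ∨ (x = 6 ∧ y = 7) ∨ (x = 7 ∧ y = 1))

/-- `S₃` (the 3-sun): a 6-cycle `0 1 2 3 4 5` together with the triangle `1 3 5`. -/
def S3 : SimpleGraph (Fin 6) := SimpleGraph.fromRel (fun x y =>
  (x = 0 ∧ y = 1) ∨ (x = 1 ∧ y = 2) ∨ (x = 2 ∧ y = 3) ∨ (x = 3 ∧ y = 4) ∨
  (x = 4 ∧ y = 5) ∨ (x = 5 ∧ y = 0) ∨ (x = 1 ∧ y = 3) ∨ (x = 3 ∧ y = 5) ∨ (x = 5 ∧ y = 1))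

/-- A graph is 2-connected if it has at least three vertices and deleting any one
vertex leaves it connected. -/
def TwoConnected {V : Type} (G : SimpleGraph V) : Prop :=
  3 ≤ Nat.card V ∧ ∀ v : V, (G.induce {x | x ≠ v}).Connected

/-- The cell completion of `G`: add an edge `vw` for every pair of (nonadjacent)
vertices `v, w` such that deleting `v` and `w` leaves at least three connected
components. -/
def cellCompletion {V : Type} (G : SimpleGraph V) : SimpleGraph V :=
  SimpleGraph.fromRel (fun v w => G.Adj v w ∨
    3 ≤ Nat.card ((G.induce {x | x ≠ v ∧ x ≠ w}).ConnectedComponent))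

/-- The induced subgraph of `G` on `S` has no cut vertex. -/
def NoCutVertex {V : Type} (G : SimpleGraph V) (S : Set V) : Prop :=
  ∀ v ∈ S, (S \ {v}).Nonempty → (G.induce (S \ {v})).Connected

/-- `S` carries a block of `G`: a maximal connected (induced) subgraph without a
cut vertex. -/
def IsBlock {V : Type} (G : SimpleGraph V) (S : Set V) : Prop :=
  S.Nonempty ∧ (G.induce S).Connected ∧ NoCutVertex G S ∧
    ∀ S' : Set V, S ⊆ S' → (G.induce S').Connected → NoCutVertex G S' → S' = S

/-- Glue a cycle of length `n` onto the graph `G` by identifying the cycle edge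
`{0, 1}` (with its end vertices) with the edge `{a, b}` of `G`. -/
def glueCycle {V : Type} (G : SimpleGraph V) (n : ℕ) (a b : V) :
    SimpleGraph (V ⊕ {x : ZMod n // x ≠ 0 ∧ x ≠ 1}) :=
  SimpleGraph.fromRel (fun p q =>
    match p, q with
    | Sum.inl u, Sum.inl v => G.Adj u v
    | Sum.inl u, Sum.inr x => (u = a ∧ (cycGraph n).Adj 0 x.1) ∨ (u = b ∧ (cycGraph n).Adj 1 x.1)
    | Sum.inr x, Sum.inr y => (cycGraph n).Adj x.1 y.1
    | Sum.inr _, Sum.inl _ => False)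

/-- The class of trees of cycles: every cycle is a tree of cycles, and gluing a
cycle onto a tree of cycles along an edge yields a tree of cycles (up to
isomorphism). -/
inductive IsTreeOfCycles : {V : Type} → SimpleGraph V → Prop
  | cycle {V : Type} (G : SimpleGraph V) (n : ℕ) (hn : 3 ≤ n)
      (e : Nonempty (G ≃g cycGraph n)) : IsTreeOfCycles G
  | glue {V W : Type} (G : SimpleGraph V) (hG : IsTreeOfCycles G)
      (n : ℕ) (hn : 3 ≤ n) (a b : V) (hab : G.Adj a b)
      (H : SimpleGraph W) (e : Nonempty (H ≃g glueCycle G n a b)) : IsTreeOfCycles H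

/-- `S` is the vertex set of a chordless cycle of `G`, i.e. it induces a cycle. -/
def IsChordlessCycle {V : Type} (G : SimpleGraph V) (S : Set V) : Prop :=
  ∃ n : ℕ, 3 ≤ n ∧ Nonempty ((G.induce S) ≃g cycGraph n)

/-- The edge `uv` is an edge separator: it lies in at least two distinct chordless
cycles of `G`. -/
def IsEdgeSeparator {V : Type} (G : SimpleGraph V) (u v : V) : Prop :=
  G.Adj u v ∧ ∃ S₁ S₂ : Set V, S₁ ≠ S₂ ∧ IsChordlessCycle G S₁ ∧ IsChordlessCycle G S₂ ∧
    u ∈ S₁ ∧ v ∈ S₁ ∧ u ∈ S₂ ∧ v ∈ S₂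

/-- `S` is a simplicial triangle of `G`: a chordless cycle on three vertices
containing a simplicial vertex of `G`. -/
def IsSimplicialTriangle {V : Type} (G : SimpleGraph V) (S : Set V) : Prop :=
  IsChordlessCycle G S ∧ S.ncard = 3 ∧ ∃ v ∈ S, G.IsClique (G.neighborSet v)

/-- A chain tree of cycles: a tree of cycles in which every edge lies in at most two
chordless cycles that are not simplicial triangles (equivalently, if an edge lies in
`m ≥ 3` chordless cycles then at least `m - 2` of them are simplicial triangles). -/
def IsChainTreeOfCycles {V : Type} (G : SimpleGraph V) : Prop :=
  IsTreeOfCycles G ∧ ∀ u v : V, G.Adj u v →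
    {S : Set V | IsChordlessCycle G S ∧ u ∈ S ∧ v ∈ S ∧ ¬ IsSimplicialTriangle G S}.ncard ≤ 2

/-- A tree of two-boundaried cycles: a tree of cycles in which every chordless
cycle contains at most two edge separators. -/
def IsTreeOfTwoBoundariedCycles {V : Type} (G : SimpleGraph V) : Prop :=
  IsTreeOfCycles G ∧ ∀ S : Set V, IsChordlessCycle G S →
    {e : Sym2 V | ∃ u v : V, e = s(u, v) ∧ u ∈ S ∧ v ∈ S ∧ IsEdgeSeparator G u v}.ncard ≤ 2

/-- A path of cycles: a tree of cycles in which every chordless cycle contains at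
most two edge separators and every edge lies in at most two chordless cycles that
are not simplicial triangles. -/
def IsPathOfCycles {V : Type} (G : SimpleGraph V) : Prop :=
  IsTreeOfCycles G ∧
    (∀ S : Set V, IsChordlessCycle G S →
      {e : Sym2 V | ∃ u v : V, e = s(u, v) ∧ u ∈ S ∧ v ∈ S ∧ IsEdgeSeparator G u v}.ncard ≤ 2) ∧
    ∀ u v : V, G.Adj u v →
      {S : Set V | IsChordlessCycle G S ∧ u ∈ S ∧ v ∈ S ∧ ¬ IsSimplicialTriangle G S}.ncard ≤ 2

/-- The graph is a single edge. -/
def IsSingleEdgeGraph {V : Type} (G : SimpleGraph V) : Prop :=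
  Nat.card V = 2 ∧ ∀ a b : V, a ≠ b → G.Adj a b

/-- A mamba: a 2-connected graph of pathwidth two, a single edge, or an isolated
vertex. -/
def IsMamba {V : Type} (G : SimpleGraph V) : Prop :=
  (TwoConnected G ∧ pw G = 2) ∨ IsSingleEdgeGraph G ∨ Nat.card V = 1

/-- `v` is a head vertex of the mamba `G`: some path decomposition of `G` of width
at most two has `v` in its first bag. -/
def IsHeadVertex {V : Type} (G : SimpleGraph V) (v : V) : Prop :=
  ∃ pd : PathDecomp G, (∀ i, (pd.bag i).ncard ≤ 3) ∧ v ∈ pd.bag ⟨0, pd.hm⟩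

/-- Glue the graph `M` onto the graph `G` by identifying the vertex `h` of `M` with
the vertex `x` of `G`. -/
def glueAtVertex {V W : Type} (G : SimpleGraph V) (x : V) (M : SimpleGraph W) (h : W) :
    SimpleGraph (V ⊕ {w : W // w ≠ h}) :=
  SimpleGraph.fromRel (fun p q =>
    match p, q with
    | Sum.inl u, Sum.inl u' => G.Adj u u'
    | Sum.inl u, Sum.inr w => u = x ∧ M.Adj h w.1
    | Sum.inr w, Sum.inr w' => M.Adj w.1 w'.1
    | Sum.inr _, Sum.inl _ => False)

/-- The class of mamba trees: every mamba is a mamba tree, and gluing a mamba onto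
a mamba tree by identifying a vertex of the mamba tree with a head vertex of the
mamba yields a mamba tree (up to isomorphism). -/
inductive IsMambaTree : {V : Type} → SimpleGraph V → Prop
  | mamba {V : Type} (G : SimpleGraph V) (hG : IsMamba G) : IsMambaTree G
  | glue {V W U : Type} (G : SimpleGraph V) (hG : IsMambaTree G)
      (M : SimpleGraph W) (hM : IsMamba M) (x : V) (h : W) (hh : IsHeadVertex M h)
      (K : SimpleGraph U) (e : Nonempty (K ≃g glueAtVertex G x M h)) : IsMambaTree K

/-- Subdivide the edge `{a, b}` of `G` by a new vertex. -/
def subdivideEdge {V : Type} (G : SimpleGraph V) (a b : V) : SimpleGraph (V ⊕ Unit) :=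
  SimpleGraph.fromRel (fun p q =>
    match p, q with
    | Sum.inl u, Sum.inl v => G.Adj u v ∧ ¬(u = a ∧ v = b) ∧ ¬(u = b ∧ v = a)
    | Sum.inl u, Sum.inr _ => u = a ∨ u = b
    | Sum.inr _, _ => False)

/-- `H` is a subdivision of `G`: `H` is obtained from (an isomorphic copy of) `G`
by repeatedly subdividing edges. -/
inductive IsSubdivisionOf : {W V : Type} → SimpleGraph W → SimpleGraph V → Prop
  | base {V W : Type} {G : SimpleGraph V} {H : SimpleGraph W}
      (e : Nonempty (H ≃g G)) : IsSubdivisionOf H G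
  | step {V W U : Type} {G : SimpleGraph V} {H : SimpleGraph W} (a b : W) (hab : H.Adj a b)
      (h : IsSubdivisionOf H G) {K : SimpleGraph U}
      (e : Nonempty (K ≃g subdivideEdge H a b)) : IsSubdivisionOf K G

/-- Contract the edge `{a, b}` of `G` (the contracted vertex is `a`, `b` is removed). -/
def contractEdge {V : Type} (G : SimpleGraph V) (a b : V) : SimpleGraph {x : V // x ≠ b} :=
  SimpleGraph.fromRel (fun x y =>
    G.Adj x.1 y.1 ∨ (x.1 = a ∧ G.Adj b y.1) ∨ (y.1 = a ∧ G.Adj b x.1))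

/-! ### Connected vertex sets -/

/-- Connectedness of a vertex set in the form of an induction principle. -/
def ConnSet {V : Type} (G : SimpleGraph V) (S : Set V) : Prop :=
  S.Nonempty ∧ ∀ Z : Set V, (∃ x ∈ S, x ∈ Z) →
    (∀ u ∈ S, u ∈ Z → ∀ v ∈ S, G.Adj u v → v ∈ Z) → S ⊆ Z

theorem connSet_iff {V : Type} {G : SimpleGraph V} {S : Set V} :
    ConnSet G S ↔ (G.induce S).Connected := by
  constructor
  · rintro ⟨⟨x, hx⟩, h⟩
    have key : ∀ y (hy : y ∈ S), (G.induce S).Reachable ⟨x, hx⟩ ⟨y, hy⟩ := by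
      have := h {y | ∃ hy : y ∈ S, (G.induce S).Reachable ⟨x, hx⟩ ⟨y, hy⟩}
        ⟨x, hx, hx, Reachable.refl _⟩ (by
          rintro u hu ⟨_, hr⟩ v hv huv
          refine ⟨hv, hr.trans (Adj.reachable ?_)⟩
          simpa using huv)
      intro y hy
      exact (this hy).2
    have : Nonempty S := ⟨⟨x, hx⟩⟩
    refine ⟨fun a b => (key a.1 a.2).symm.trans (key b.1 b.2)⟩
  · intro h
    obtain ⟨x0⟩ := h.nonempty
    refine ⟨⟨x0.1, x0.2⟩, fun Z ⟨x, hx, hxZ⟩ hcl y hy => ?_⟩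
    obtain ⟨w⟩ := h.preconnected ⟨x, hx⟩ ⟨y, hy⟩
    have : ∀ (a b : S), (G.induce S).Walk a b → a.1 ∈ Z → b.1 ∈ Z := by
      intro a b w
      induction w with
      | nil => exact id
      | cons hadj _ ih =>
        intro ha
        exact ih (hcl _ (Subtype.property _) ha _ (Subtype.property _) (by simpa using hadj))
    exact this _ _ w hxZ

namespace ConnSet

variable {V : Type} {G : SimpleGraph V} {S T : Set V}

theorem exists_exit (h : ConnSet G S) (Z : Set V) {x y : V} (hx : x ∈ S) (hxZ : x ∈ Z)
    (hy : y ∈ S) (hyZ : y ∉ Z) :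
    ∃ u ∈ S, u ∈ Z ∧ ∃ v ∈ S, v ∉ Z ∧ G.Adj u v := by
  by_contra! hc
  exact hyZ (h.2 Z ⟨x, hx, hxZ⟩ (fun u hu huZ v hv huv => by
    by_contra hvZ
    exact hc u hu huZ v hv hvZ huv) hy)

theorem of_root {x : V} (hx : x ∈ S)
    (h : ∀ Z : Set V, x ∈ Z → (∀ u ∈ S, u ∈ Z → ∀ v ∈ S, G.Adj u v → v ∈ Z) → S ⊆ Z) :
    ConnSet G S := by
  refine ⟨⟨x, hx⟩, fun Z ⟨z, hz, hzZ⟩ hcl => ?_⟩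
  by_cases hxZ : x ∈ Z
  · exact h Z hxZ hcl
  · exact absurd hzZ (h Zᶜ hxZ (fun u hu huZ v hv huv hvZ => huZ (hcl v hv hvZ u hu huv.symm)) hz)

theorem singleton (x : V) : ConnSet G {x} :=
  of_root rfl (fun Z hx _ y hy => by rw [Set.mem_singleton_iff] at hy; exact hy ▸ hx)

theorem union_of_adj (hS : ConnSet G S) (hT : ConnSet G T) {u v : V} (hu : u ∈ S) (hv : v ∈ T)
    (huv : G.Adj u v) : ConnSet G (S ∪ T) := by
  refine of_root (x := u) (Or.inl hu) (fun Z huZ hcl => Set.union_subset ?_ ?_)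
  · exact hS.2 Z ⟨u, hu, huZ⟩ fun a ha haZ b hb => hcl a (Or.inl ha) haZ b (Or.inl hb)
  · refine hT.2 Z ⟨v, hv, hcl u (Or.inl hu) huZ v (Or.inr hv) huv⟩ ?_
    exact fun a ha haZ b hb => hcl a (Or.inr ha) haZ b (Or.inr hb)

theorem union_of_mem (hS : ConnSet G S) (hT : ConnSet G T) {u : V} (hu : u ∈ S) (hv : u ∈ T) :
    ConnSet G (S ∪ T) := by
  refine of_root (x := u) (Or.inl hu) (fun Z huZ hcl => Set.union_subset ?_ ?_)
  · exact hS.2 Z ⟨u, hu, huZ⟩ fun a ha haZ b hb => hcl a (Or.inl ha) haZ b (Or.inl hb)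
  · exact hT.2 Z ⟨u, hv, huZ⟩ fun a ha haZ b hb => hcl a (Or.inr ha) haZ b (Or.inr hb)

theorem insert_of_adj (hS : ConnSet G S) {u v : V} (hu : u ∈ S) (huv : G.Adj u v) :
    ConnSet G (insert v S) := by
  have := hS.union_of_adj (singleton v) hu rfl huv
  rwa [Set.union_singleton] at this

end ConnSet

/-- The component of `x` in the subgraph induced by `S`. -/
def compIn {V : Type} (G : SimpleGraph V) (S : Set V) (x : V) : Set V :=
  {y | y ∈ S ∧ ∀ Z : Set V, x ∈ Z → (∀ u ∈ S, u ∈ Z → ∀ v ∈ S, G.Adj u v → v ∈ Z) → y ∈ Z}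

section compIn

variable {V : Type} {G : SimpleGraph V} {S : Set V} {x : V}

theorem compIn_subset : compIn G S x ⊆ S := fun _ h => h.1

theorem mem_compIn_self (hx : x ∈ S) : x ∈ compIn G S x := ⟨hx, fun _ h _ => h⟩

theorem compIn_closed {u v : V} (hu : u ∈ compIn G S x) (hv : v ∈ S) (huv : G.Adj u v) :
    v ∈ compIn G S x :=
  ⟨hv, fun Z hx hcl => hcl u hu.1 (hu.2 Z hx hcl) v hv huv⟩

theorem connSet_compIn (hx : x ∈ S) : ConnSet G (compIn G S x) := by
  refine ConnSet.of_root (mem_compIn_self hx) (fun Z hxZ hcl y hy => ?_)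
  refine (hy.2 (Z ∩ compIn G S x) ⟨hxZ, mem_compIn_self hx⟩ ?_).1
  rintro u - ⟨huZ, huC⟩ v hv huv
  have hvC := compIn_closed huC hv huv
  exact ⟨hcl u huC huZ v hvC huv, hvC⟩

theorem ConnSet.subset_compIn {K : Set V} (hK : ConnSet G K) (hKS : K ⊆ S) {y : V} (hy : y ∈ K)
    (hyC : y ∈ compIn G S x) : K ⊆ compIn G S x :=
  hK.2 _ ⟨y, hy, hyC⟩ fun _ _ huZ _ hv huv => compIn_closed huZ (hKS hv) huv

/-- A connected set leaving `S` has an edge from the component of `x` in `K ∩ S` to `K \ S`. -/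
theorem ConnSet.exists_adj_compIn {K : Set V} (hK : ConnSet G K) (hSK : S ⊆ K) (hx : x ∈ S)
    {y : V} (hy : y ∈ K) (hyS : y ∉ S) :
    ∃ u ∈ compIn G S x, ∃ v ∈ K, v ∉ S ∧ G.Adj u v := by
  obtain ⟨u, -, huC, v, hvK, hvC, huv⟩ := hK.exists_exit (compIn G S x) (hSK hx)
    (mem_compIn_self hx) hy (fun h => hyS h.1)
  exact ⟨u, huC, v, hvK, fun hvS => hvC (compIn_closed huC hvS huv), huv⟩

end compIn

/-! ### Two disjoint connections between two sets -/

/-- `K` is a connected subset of `C` meeting both `X` and `Y`. -/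
def Links {V : Type} (G : SimpleGraph V) (C X Y K : Set V) : Prop :=
  ConnSet G K ∧ K ⊆ C ∧ (∃ x ∈ K, x ∈ X) ∧ (∃ y ∈ K, y ∈ Y)

theorem Links.symm {V : Type} {G : SimpleGraph V} {C X Y K : Set V} (h : Links G C X Y K) :
    Links G C Y X K := ⟨h.1, h.2.1, h.2.2.2, h.2.2.1⟩

/-- The initial part of a connected set, from a given vertex to its first hit of `W`. -/
theorem ConnSet.exists_initial {V : Type} {G : SimpleGraph V} {K W : Set V} (hK : ConnSet G K)
    {x w : V} (hx : x ∈ K) (hw : w ∈ K) (hwW : w ∈ W) :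
    ∃ K' ⊆ K, ConnSet G K' ∧ x ∈ K' ∧ (∃ v ∈ K', v ∈ W) ∧
      ∀ a ∈ K', a ∉ W → ∃ K'' ⊆ K \ W, ConnSet G K'' ∧ x ∈ K'' ∧ a ∈ K'' := by
  by_cases hxW : x ∈ W
  · refine ⟨{x}, by simpa using hx, .singleton x, rfl, ⟨x, rfl, hxW⟩, ?_⟩
    rintro a rfl ha
    exact absurd hxW ha
  · obtain ⟨u, hu, v, hv, hvS, huv⟩ := hK.exists_adj_compIn (S := K \ W) Set.sdiff_subset
      ⟨hx, hxW⟩ hw (fun h => h.2 hwW)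
    have hvW : v ∈ W := by
      by_contra h
      exact hvS ⟨hv, h⟩
    have hc := connSet_compIn (G := G) (S := K \ W) (x := x) ⟨hx, hxW⟩
    refine ⟨insert v (compIn G (K \ W) x), ?_, hc.insert_of_adj hu huv,
      Or.inr (mem_compIn_self ⟨hx, hxW⟩), ⟨v, Or.inl rfl, hvW⟩, ?_⟩
    · rintro a (rfl | ha)
      exacts [hv, (compIn_subset ha).1]
    · rintro a (rfl | ha) haW
      · exact absurd hvW haW
      · exact ⟨_, compIn_subset, hc, mem_compIn_self ⟨hx, hxW⟩, ha⟩

theorem Links.pair_order {V : Type} {G : SimpleGraph V} {C X : Set V} {c z : V} {P₁ P₂ : Set V}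
    (h₁ : Links G C X {c, z} P₁) (h₂ : Links G C X {c, z} P₂) (hd : Disjoint P₁ P₂) :
    ∃ P₁ P₂, Links G C X {c, z} P₁ ∧ Links G C X {c, z} P₂ ∧ Disjoint P₁ P₂ ∧ c ∈ P₁ ∧ z ∈ P₂ := by
  obtain ⟨y₁, hy₁, rfl | rfl⟩ := h₁.2.2.2 <;> obtain ⟨y₂, hy₂, rfl | rfl⟩ := h₂.2.2.2
  · exact absurd hy₂ (Set.disjoint_left.1 hd hy₁)
  · exact ⟨P₁, P₂, h₁, h₂, hd, hy₁, hy₂⟩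
  · exact ⟨P₂, P₁, h₂, h₁, hd.symm, hy₂, hy₁⟩
  · exact absurd hy₂ (Set.disjoint_left.1 hd hy₁)

/-- Menger's theorem for two disjoint paths between `X` and `Y` inside `C`. -/
theorem exists_disjoint_links {V : Type} [Finite V] {G : SimpleGraph V} (n : ℕ) :
    ∀ C X Y : Set V, C.ncard = n → (∃ K, Links G C X Y K) →
      (∀ c ∈ C, ∃ K, Links G C X Y K ∧ c ∉ K) →
      ∃ K₁ K₂, Links G C X Y K₁ ∧ Links G C X Y K₂ ∧ Disjoint K₁ K₂ := by
  induction n using Nat.strong_induction_on with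
  | _ n ih =>
  intro C X Y hn hex hav
  by_cases h1 : ∃ z ∈ C, z ∈ X ∧ z ∈ Y
  · obtain ⟨z, hz, hzX, hzY⟩ := h1
    obtain ⟨K, hK, hzK⟩ := hav z hz
    exact ⟨{z}, K, ⟨.singleton z, by simpa using hz, ⟨z, rfl, hzX⟩, z, rfl, hzY⟩, hK,
      Set.disjoint_singleton_left.2 hzK⟩
  by_cases h2 : ∃ z ∈ C, z ∉ X ∧ z ∉ Y
  · obtain ⟨z, hz, hzX, hzY⟩ := h2
    by_cases h3 : ∀ c ∈ C \ {z}, ∃ K, Links G (C \ {z}) X Y K ∧ c ∉ K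
    · obtain ⟨K, hK, hzK⟩ := hav z hz
      obtain ⟨K₁, K₂, hK₁, hK₂, hd⟩ := ih _ (hn ▸ Set.ncard_sdiff_singleton_lt_of_mem hz)
        (C \ {z}) X Y rfl
        ⟨K, hK.1, fun a ha => ⟨hK.2.1 ha, fun h => hzK (h ▸ ha)⟩, hK.2.2⟩ h3
      exact ⟨K₁, K₂, ⟨hK₁.1, hK₁.2.1.trans Set.sdiff_subset, hK₁.2.2⟩,
        ⟨hK₂.1, hK₂.2.1.trans Set.sdiff_subset, hK₂.2.2⟩, hd⟩
    · push Not at h3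
      obtain ⟨c, hc, hcz⟩ := h3
      have hhit : ∀ K, Links G C X Y K → ∃ w ∈ K, w ∈ ({c, z} : Set V) := by
        intro K hK
        by_cases hzK : z ∈ K
        · exact ⟨z, hzK, Or.inr rfl⟩
        · exact ⟨c, hcz K ⟨hK.1, fun a ha => ⟨hK.2.1 ha, fun h => hzK (h ▸ ha)⟩, hK.2.2⟩,
            Or.inl rfl⟩
      obtain ⟨Kc, hKc, hcKc⟩ := hav c hc.1
      let L : Set V := {v | ∃ K, ConnSet G K ∧ K ⊆ C \ {c, z} ∧ v ∈ K ∧ ∃ x ∈ K, x ∈ X}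
      have hLC : L ⊆ C \ {c, z} := fun v ⟨K, _, hK, hv, _⟩ => hK hv
      have hpair : ({c, z} : Set V) ⊆ C := by
        rintro a (rfl | rfl)
        exacts [hc.1, hz]
      -- the part of a link on the side of `X`
      have hleft : ∀ K, Links G C X Y K → ∃ K' ⊆ K, Links G (L ∪ {c, z}) X {c, z} K' := by
        intro K hK
        obtain ⟨w, hw, hwW⟩ := hhit K hK
        obtain ⟨x, hx, hxX⟩ := hK.2.2.1
        obtain ⟨K', hK'K, hc', hxK', hv, hL⟩ := hK.1.exists_initial hx hw hwW
        refine ⟨K', hK'K, hc', fun a ha => ?_, ⟨x, hxK', hxX⟩, hv⟩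
        by_cases haW : a ∈ ({c, z} : Set V)
        · exact Or.inr haW
        · obtain ⟨K'', h1, h2, h3, h4⟩ := hL a ha haW
          exact Or.inl ⟨K'', h2, fun b hb => ⟨hK.2.1 (h1 hb).1, (h1 hb).2⟩, h4, x, h3, hxX⟩
      -- the part of a link on the side of `Y`
      have hright : ∀ K, Links G C X Y K → ∃ K' ⊆ K, Links G (C \ L) Y {c, z} K' := by
        intro K hK
        obtain ⟨w, hw, hwW⟩ := hhit K hK
        obtain ⟨y, hy, hyY⟩ := hK.2.2.2
        obtain ⟨K', hK'K, hc', hyK', hv, hL⟩ := hK.1.exists_initial hy hw hwW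
        refine ⟨K', hK'K, hc', fun a ha => ⟨hK.2.1 (hK'K ha), ?_⟩, ⟨y, hyK', hyY⟩, hv⟩
        intro haL
        obtain ⟨K'', h1, h2, h3, h4⟩ := hL a ha (hLC haL).2
        obtain ⟨J, hJ, hJC, haJ, x, hxJ, hxX⟩ := haL
        obtain ⟨w', hw', hw'W⟩ := hhit (J ∪ K'') ⟨hJ.union_of_mem h2 haJ h4,
          Set.union_subset (hJC.trans Set.sdiff_subset) (fun b hb => hK.2.1 (h1 hb).1),
          ⟨x, Or.inl hxJ, hxX⟩, ⟨y, Or.inr h3, hyY⟩⟩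
        rcases hw' with hw' | hw'
        exacts [(hJC hw').2 hw'W, (h1 hw').2 hw'W]
      have hX : ∃ x ∈ C, x ∈ X ∧ x ∉ ({c, z} : Set V) := by
        obtain ⟨x, hx, hxX⟩ := hKc.2.2.1
        refine ⟨x, hKc.2.1 hx, hxX, ?_⟩
        rintro (rfl | rfl)
        exacts [hcKc hx, hzX hxX]
      have hY : ∃ y ∈ C, y ∈ Y ∧ y ∉ ({c, z} : Set V) := by
        obtain ⟨y, hy, hyY⟩ := hKc.2.2.2
        refine ⟨y, hKc.2.1 hy, hyY, ?_⟩
        rintro (rfl | rfl)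
        exacts [hcKc hy, hzY hyY]
      have hltL : (L ∪ {c, z}).ncard < n := by
        rw [← hn]
        refine Set.ncard_lt_ncard ⟨Set.union_subset (hLC.trans Set.sdiff_subset) hpair, ?_⟩
        obtain ⟨y, hyC, hyY, hyW⟩ := hY
        intro hsub
        rcases hsub hyC with ⟨K, hK, hKC, hyK, hxK⟩ | h
        · obtain ⟨w, hw, hwW⟩ := hhit K ⟨hK, hKC.trans Set.sdiff_subset, hxK, y, hyK, hyY⟩
          exact (hKC hw).2 hwW
        · exact hyW h
      have hltR : (C \ L).ncard < n := by
        rw [← hn]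
        obtain ⟨x, hxC, hxX, hxW⟩ := hX
        refine Set.ncard_lt_ncard ⟨Set.sdiff_subset, fun hsub => (hsub hxC).2 ?_⟩
        exact ⟨{x}, .singleton x, by rintro _ rfl; exact ⟨hxC, hxW⟩, rfl, x, rfl, hxX⟩
      obtain ⟨P₁, P₂, hP₁, hP₂, hPd⟩ := ih _ hltL (L ∪ {c, z}) X {c, z} rfl
        (by obtain ⟨K', -, h⟩ := hleft Kc hKc; exact ⟨K', h⟩)
        (fun d hd => by
          obtain ⟨K, hK, hdK⟩ := hav d
            ((Set.union_subset (hLC.trans Set.sdiff_subset) hpair) hd)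
          obtain ⟨K', hsub, h⟩ := hleft K hK
          exact ⟨K', h, fun h => hdK (hsub h)⟩)
      obtain ⟨Q₁, Q₂, hQ₁, hQ₂, hQd⟩ := ih _ hltR (C \ L) Y {c, z} rfl
        (by obtain ⟨K', -, h⟩ := hright Kc hKc; exact ⟨K', h⟩)
        (fun d hd => by
          obtain ⟨K, hK, hdK⟩ := hav d hd.1
          obtain ⟨K', hsub, h⟩ := hright K hK
          exact ⟨K', h, fun h => hdK (hsub h)⟩)
      obtain ⟨P₁, P₂, hP₁, hP₂, hPd, hcP, hzP⟩ := hP₁.pair_order hP₂ hPd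
      obtain ⟨Q₁, Q₂, hQ₁, hQ₂, hQd, hcQ, hzQ⟩ := hQ₁.pair_order hQ₂ hQd
      have hglue : ∀ P Q w, Links G (L ∪ {c, z}) X {c, z} P → Links G (C \ L) Y {c, z} Q →
          w ∈ P → w ∈ Q → Links G C X Y (P ∪ Q) := by
        intro P Q w hP hQ hwP hwQ
        refine ⟨hP.1.union_of_mem hQ.1 hwP hwQ, Set.union_subset (hP.2.1.trans ?_)
          (hQ.2.1.trans Set.sdiff_subset), ?_, ?_⟩
        · exact Set.union_subset (hLC.trans Set.sdiff_subset) hpair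
        · obtain ⟨x, hx, hxX⟩ := hP.2.2.1
          exact ⟨x, Or.inl hx, hxX⟩
        · obtain ⟨y, hy, hyY⟩ := hQ.2.2.1
          exact ⟨y, Or.inr hy, hyY⟩
      have hcross : ∀ P Q P' Q', Links G (L ∪ {c, z}) X {c, z} P → Links G (C \ L) Y {c, z} Q' →
          (c ∈ P' ∧ c ∈ Q' ∧ z ∈ P ∧ z ∈ Q ∨ z ∈ P' ∧ z ∈ Q' ∧ c ∈ P ∧ c ∈ Q) →
          Disjoint P P' → Disjoint Q Q' → ∀ a ∈ P, a ∉ Q' := by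
        intro P Q P' Q' hP hQ' hcz hPP hQQ a haP haQ'
        rw [Set.disjoint_left] at hPP hQQ
        have haW : a = c ∨ a = z := (hP.2.1 haP).resolve_left (hQ'.2.1 haQ').2
        rcases hcz with ⟨h1, h2, h3, h4⟩ | ⟨h1, h2, h3, h4⟩ <;> rcases haW with rfl | rfl
        exacts [hPP haP h1, hQQ h4 haQ', hQQ h4 haQ', hPP haP h1]
      refine ⟨P₁ ∪ Q₁, P₂ ∪ Q₂, hglue _ _ c hP₁ hQ₁ hcP hcQ, hglue _ _ z hP₂ hQ₂ hzP hzQ, ?_⟩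
      rw [Set.disjoint_left]
      rintro a (haP | haQ) (haP' | haQ')
      · exact Set.disjoint_left.1 hPd haP haP'
      · exact hcross P₁ Q₁ P₂ Q₂ hP₁ hQ₂ (Or.inr ⟨hzP, hzQ, hcP, hcQ⟩) hPd hQd a haP haQ'
      · exact hcross P₂ Q₂ P₁ Q₁ hP₂ hQ₁ (Or.inl ⟨hcP, hcQ, hzP, hzQ⟩) hPd.symm hQd.symm a haP' haQ
      · exact Set.disjoint_left.1 hQd haQ haQ'
  · push Not at h1 h2
    have hedge : ∀ K, Links G C X Y K →
        ∃ x ∈ K, x ∈ X ∧ ∃ y ∈ K, y ∈ Y ∧ G.Adj x y := by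
      intro K hK
      obtain ⟨x, hx, hxX⟩ := hK.2.2.1
      obtain ⟨y, hy, hyY⟩ := hK.2.2.2
      obtain ⟨u, hu, huX, v, hv, hvX, huv⟩ := hK.1.exists_exit X hx hxX hy
        (fun h => h1 y (hK.2.1 hy) h hyY)
      exact ⟨u, hu, huX, v, hv, h2 v (hK.2.1 hv) hvX, huv⟩
    have hmk : ∀ x y, x ∈ C → x ∈ X → y ∈ C → y ∈ Y → G.Adj x y → Links G C X Y {x, y} := by
      intro x y hxC hxX hyC hyY hxy
      refine ⟨?_, ?_, ⟨x, Or.inl rfl, hxX⟩, ⟨y, Or.inr rfl, hyY⟩⟩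
      · exact (ConnSet.singleton y).insert_of_adj rfl hxy.symm
      · rintro a (rfl | rfl)
        exacts [hxC, hyC]
    have hne : ∀ x y, x ∈ C → x ∈ X → y ∈ Y → x ≠ y := fun x y hxC hxX hyY h =>
      h1 x hxC hxX (h ▸ hyY)
    have hdis : ∀ x y x' y', x ∈ C → x ∈ X → y ∈ C → y ∈ Y → G.Adj x y →
        x' ∈ C → x' ∈ X → y' ∈ C → y' ∈ Y → G.Adj x' y' → x ≠ x' → y ≠ y' →
        ∃ K₁ K₂, Links G C X Y K₁ ∧ Links G C X Y K₂ ∧ Disjoint K₁ K₂ := by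
      intro x y x' y' a1 a2 a3 a4 a5 b1 b2 b3 b4 b5 n1 n2
      refine ⟨_, _, hmk x y a1 a2 a3 a4 a5, hmk x' y' b1 b2 b3 b4 b5, ?_⟩
      have := hne x y' a1 a2 b4
      have := hne x' y b1 b2 a4
      rw [Set.disjoint_left]
      rintro a (rfl | rfl) (h | h) <;> simp_all
    obtain ⟨K, hK⟩ := hex
    obtain ⟨x, hx, hxX, y, hy, hyY, hxy⟩ := hedge K hK
    obtain ⟨K₁, hK₁, hxK₁⟩ := hav x (hK.2.1 hx)
    obtain ⟨x₁, hx₁, hx₁X, y₁, hy₁, hy₁Y, hxy₁⟩ := hedge K₁ hK₁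
    obtain ⟨K₂, hK₂, hyK₂⟩ := hav y (hK.2.1 hy)
    obtain ⟨x₂, hx₂, hx₂X, y₂, hy₂, hy₂Y, hxy₂⟩ := hedge K₂ hK₂
    have nx₁ : x ≠ x₁ := fun h => hxK₁ (h ▸ hx₁)
    have ny₂ : y ≠ y₂ := fun h => hyK₂ (h ▸ hy₂)
    by_cases e₁ : y = y₁
    · by_cases e₂ : x = x₂
      · exact hdis x₁ y₁ x₂ y₂ (hK₁.2.1 hx₁) hx₁X (hK₁.2.1 hy₁) hy₁Y hxy₁ (hK₂.2.1 hx₂) hx₂X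
          (hK₂.2.1 hy₂) hy₂Y hxy₂ (e₂ ▸ nx₁.symm) (e₁ ▸ ny₂)
      · exact hdis x y x₂ y₂ (hK.2.1 hx) hxX (hK.2.1 hy) hyY hxy (hK₂.2.1 hx₂) hx₂X
          (hK₂.2.1 hy₂) hy₂Y hxy₂ e₂ ny₂
    · exact hdis x y x₁ y₁ (hK.2.1 hx) hxX (hK.2.1 hy) hyY hxy (hK₁.2.1 hx₁) hx₁X
        (hK₁.2.1 hy₁) hy₁Y hxy₁ nx₁ e₁

/-! ### Lobes and minors -/

section Minors

variable {V : Type} {G : SimpleGraph V}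

theorem isMinorOf_K4 {A B C D : Set V} (hA : ConnSet G A) (hB : ConnSet G B) (hC : ConnSet G C)
    (hD : ConnSet G D) (dAB : Disjoint A B) (dAC : Disjoint A C) (dAD : Disjoint A D)
    (dBC : Disjoint B C) (dBD : Disjoint B D) (dCD : Disjoint C D)
    (eAB : ∃ u ∈ A, ∃ v ∈ B, G.Adj u v) (eAC : ∃ u ∈ A, ∃ v ∈ C, G.Adj u v)
    (eAD : ∃ u ∈ A, ∃ v ∈ D, G.Adj u v) (eBC : ∃ u ∈ B, ∃ v ∈ C, G.Adj u v)
    (eBD : ∃ u ∈ B, ∃ v ∈ D, G.Adj u v) (eCD : ∃ u ∈ C, ∃ v ∈ D, G.Adj u v) :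
    IsMinorOf K4 G := by
  have sw : ∀ {A B : Set V}, (∃ u ∈ A, ∃ v ∈ B, G.Adj u v) → ∃ u ∈ B, ∃ v ∈ A, G.Adj u v :=
    fun ⟨u, hu, v, hv, h⟩ => ⟨v, hv, u, hu, h.symm⟩
  refine ⟨![A, B, C, D], ?_, ?_, ?_, ?_⟩
  · intro w
    fin_cases w
    exacts [hA.1, hB.1, hC.1, hD.1]
  · intro w
    fin_cases w
    exacts [connSet_iff.1 hA, connSet_iff.1 hB, connSet_iff.1 hC, connSet_iff.1 hD]
  · intro w w' hne
    fin_cases w <;> fin_cases w' <;>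
      first | exact absurd rfl hne | assumption | (apply Disjoint.symm; assumption)
  · intro w w' hadj
    have hne := hadj.ne
    fin_cases w <;> fin_cases w' <;>
      first | exact absurd rfl hne | assumption | (apply sw; assumption)

theorem isMinorOf_D3 {s t : V} (hst : s ≠ t) {A B : Fin 3 → Set V} (hA : ∀ i, ConnSet G (A i))
    (hB : ∀ i, ConnSet G (B i)) (sA : ∀ i, s ∉ A i) (tA : ∀ i, t ∉ A i) (sB : ∀ i, s ∉ B i)
    (tB : ∀ i, t ∉ B i) (dA : Pairwise fun i j => Disjoint (A i) (A j))
    (dB : Pairwise fun i j => Disjoint (B i) (B j)) (dAB : ∀ i j, Disjoint (A i) (B j))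
    (esA : ∀ i, ∃ u ∈ A i, G.Adj s u) (etB : ∀ i, ∃ u ∈ B i, G.Adj t u)
    (eAB : ∀ i, ∃ u ∈ A i, ∃ v ∈ B i, G.Adj u v) : IsMinorOf D3 G := by
  have sw : ∀ {A B : Set V}, (∃ u ∈ A, ∃ v ∈ B, G.Adj u v) → ∃ u ∈ B, ∃ v ∈ A, G.Adj u v :=
    fun ⟨u, hu, v, hv, h⟩ => ⟨v, hv, u, hu, h.symm⟩
  let f : Fin 8 → Set V := ![{s}, {t}, A 0, B 0, A 1, B 1, A 2, B 2]
  have hf : ∀ w, ConnSet G (f w) := by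
    intro w
    fin_cases w
    exacts [.singleton s, .singleton t, hA 0, hB 0, hA 1, hB 1, hA 2, hB 2]
  refine ⟨f, fun w => (hf w).1, fun w => connSet_iff.1 (hf w), ?_, ?_⟩
  · have key : ∀ w w', w < w' → Disjoint (f w) (f w') := by
      have h1 : ∀ i, Disjoint {s} (A i) := fun i => Set.disjoint_singleton_left.2 (sA i)
      have h2 : ∀ i, Disjoint {t} (A i) := fun i => Set.disjoint_singleton_left.2 (tA i)
      have h3 : ∀ i, Disjoint {s} (B i) := fun i => Set.disjoint_singleton_left.2 (sB i)
      have h4 : ∀ i, Disjoint {t} (B i) := fun i => Set.disjoint_singleton_left.2 (tB i)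
      have h5 : Disjoint ({s} : Set V) {t} := by simpa using hst
      have h6 : ∀ i j, Disjoint (B j) (A i) := fun i j => (dAB i j).symm
      intro w w' hlt
      fin_cases w <;> fin_cases w' <;>
        first
        | exact absurd hlt (by decide)
        | exact h1 _ | exact h2 _ | exact h3 _ | exact h4 _ | exact h5 | exact h6 _ _
        | exact dAB _ _ | exact dA (by decide) | exact dB (by decide)
    intro w w' hne
    rcases lt_or_gt_of_ne hne with h | h
    exacts [key _ _ h, (key _ _ h).symm]
  · have key : ∀ x y : Fin 8, ((x = 0 ∧ y = 2) ∨ (x = 2 ∧ y = 3) ∨ (x = 3 ∧ y = 1) ∨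
        (x = 0 ∧ y = 4) ∨ (x = 4 ∧ y = 5) ∨ (x = 5 ∧ y = 1) ∨
        (x = 0 ∧ y = 6) ∨ (x = 6 ∧ y = 7) ∨ (x = 7 ∧ y = 1)) →
        ∃ u ∈ f x, ∃ v ∈ f y, G.Adj u v := by
      have h1 : ∀ i, ∃ u ∈ ({s} : Set V), ∃ v ∈ A i, G.Adj u v := fun i => ⟨s, rfl, esA i⟩
      have h2 : ∀ i, ∃ u ∈ B i, ∃ v ∈ ({t} : Set V), G.Adj u v :=
        fun i => (etB i).imp fun u h => ⟨h.1, t, rfl, h.2.symm⟩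
      rintro x y h
      rcases h with ⟨rfl, rfl⟩ | ⟨rfl, rfl⟩ | ⟨rfl, rfl⟩ | ⟨rfl, rfl⟩ | ⟨rfl, rfl⟩ | ⟨rfl, rfl⟩ |
        ⟨rfl, rfl⟩ | ⟨rfl, rfl⟩ | ⟨rfl, rfl⟩
      exacts [h1 0, eAB 0, h2 0, h1 1, eAB 1, h2 1, h1 2, eAB 2, h2 2]
    intro w w' hadj
    rw [D3, SimpleGraph.fromRel_adj] at hadj
    rcases hadj.2 with h | h
    · exact key _ _ h
    · exact sw (key _ _ h)

/-- A connected set with two distinct vertices splits into two adjacent connected parts. -/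
theorem ConnSet.exists_split {K : Set V} (hK : ConnSet G K) {u w : V} (hu : u ∈ K) (hw : w ∈ K)
    (huw : u ≠ w) : ∃ A B, A ⊆ K ∧ B ⊆ K ∧ ConnSet G A ∧ ConnSet G B ∧ Disjoint A B ∧
      u ∈ A ∧ w ∈ B ∧ ∃ a ∈ A, ∃ b ∈ B, G.Adj a b := by
  have hwS : w ∈ K \ {u} := ⟨hw, fun h => huw h.symm⟩
  obtain ⟨b, hb, v, hv, hvS, hbv⟩ := hK.exists_adj_compIn (S := K \ {u}) Set.sdiff_subset hwS hu
    (fun h => h.2 rfl)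
  have hvu : v = u := by
    by_contra h
    exact hvS ⟨hv, h⟩
  refine ⟨{u}, compIn G (K \ {u}) w, by simpa using hu, compIn_subset.trans Set.sdiff_subset,
    .singleton u, connSet_compIn hwS, ?_, rfl, mem_compIn_self hwS, u, rfl, b, hb,
    (hvu ▸ hbv).symm⟩
  exact Set.disjoint_singleton_left.2 fun h => h.1.2 rfl

/-- Three disjoint connected sets, each joined to `s` and `t` at distinct vertices. -/
theorem isMinorOf_D3_of_connSet {s t : V} (hst : s ≠ t) {K : Fin 3 → Set V}
    (hK : ∀ i, ConnSet G (K i)) (hs : ∀ i, s ∉ K i) (ht : ∀ i, t ∉ K i)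
    (hd : Pairwise fun i j => Disjoint (K i) (K j))
    (he : ∀ i, ∃ u ∈ K i, ∃ w ∈ K i, u ≠ w ∧ G.Adj s u ∧ G.Adj t w) : IsMinorOf D3 G := by
  choose u hu w hw huw hsu htw using he
  choose A B hA hB cA cB dAB huA hwB hab using fun i => (hK i).exists_split (hu i) (hw i) (huw i)
  refine isMinorOf_D3 hst cA cB (fun i h => hs i (hA i h)) (fun i h => ht i (hA i h))
    (fun i h => hs i (hB i h)) (fun i h => ht i (hB i h)) (fun i j h => (hd h).mono (hA i) (hA j))
    (fun i j h => (hd h).mono (hB i) (hB j)) (fun i j => ?_) (fun i => ⟨_, huA i, hsu i⟩)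
    (fun i => ⟨_, hwB i, htw i⟩) hab
  by_cases h : i = j
  · exact h ▸ dAB i
  · exact (hd h).mono (hA i) (hB j)

/-- `K` is (the vertex set of) a component of `G - {s, t}`. -/
structure IsLobe (G : SimpleGraph V) (s t : V) (K : Set V) : Prop where
  conn : ConnSet G K
  left_notMem : s ∉ K
  right_notMem : t ∉ K
  closed : ∀ u ∈ K, ∀ v, G.Adj u v → v ∈ K ∨ v = s ∨ v = t

namespace IsLobe

variable {s t : V} {K : Set V}

theorem symm (h : IsLobe G s t K) : IsLobe G t s K :=
  ⟨h.conn, h.right_notMem, h.left_notMem, fun u hu v huv => (h.closed u hu v huv).imp_right Or.symm⟩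

theorem exists_adj_right (h : IsLobe G s t K) (h2 : ∀ v, ConnSet G {x | x ≠ v}) (hst : s ≠ t) :
    ∃ u ∈ K, G.Adj t u := by
  obtain ⟨x, hx⟩ := h.conn.1
  obtain ⟨u, -, hu, v, hv, hvK, huv⟩ := (h2 s).exists_exit K (x := x) (y := t)
    (fun e => h.left_notMem (e ▸ hx)) hx hst.symm h.right_notMem
  rcases h.closed u hu v huv with h' | rfl | rfl
  exacts [absurd h' hvK, absurd rfl hv, ⟨u, hu, huv.symm⟩]

theorem exists_adj_left (h : IsLobe G s t K) (h2 : ∀ v, ConnSet G {x | x ≠ v}) (hst : s ≠ t) :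
    ∃ u ∈ K, G.Adj s u :=
  h.symm.exists_adj_right h2 hst.symm

/-- A lobe with at least two vertices is joined to `s` and `t` by two disjoint edges. -/
theorem exists_matching (h : IsLobe G s t K) (h2 : ∀ v, ConnSet G {x | x ≠ v}) (hst : s ≠ t)
    (hK : K.Nontrivial) : ∃ u ∈ K, ∃ w ∈ K, u ≠ w ∧ G.Adj s u ∧ G.Adj t w := by
  by_contra! hc
  obtain ⟨c, hcK, hsc⟩ := h.exists_adj_left h2 hst
  obtain ⟨w, hwK, htw⟩ := h.exists_adj_right h2 hst
  have hcw : c = w := by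
    by_contra hne
    exact hc c hcK w hwK hne hsc htw
  subst hcw
  obtain ⟨d, hdK, hdc⟩ := hK.exists_ne c
  obtain ⟨u, -, ⟨huK, huc⟩, v, hv, hvK, huv⟩ := (h2 c).exists_exit (K \ {c}) (x := d) (y := s)
    hdc ⟨hdK, hdc⟩ (fun e => h.left_notMem (e ▸ hcK)) (fun h' => h.left_notMem h'.1)
  rcases h.closed u huK v huv with h' | rfl | rfl
  · exact hvK ⟨h', hv⟩
  · exact hc u huK c hcK huc huv.symm htw
  · exact hc c hcK u huK (fun e => huc e.symm) hsc huv.symm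

theorem subset_of_mem {K' : Set V} (h : IsLobe G s t K) (h' : IsLobe G s t K') {x : V} (hx : x ∈ K)
    (hx' : x ∈ K') : K ⊆ K' :=
  h.conn.2 K' ⟨x, hx, hx'⟩ fun u _ huK' v hv huv =>
    (h'.closed u huK' v huv).resolve_right
      (by rintro (rfl | rfl); exacts [h.left_notMem hv, h.right_notMem hv])

theorem eq_or_disjoint {K' : Set V} (h : IsLobe G s t K) (h' : IsLobe G s t K') :
    K = K' ∨ Disjoint K K' := by
  by_cases hd : Disjoint K K'
  · exact Or.inr hd
  · obtain ⟨x, hx, hx'⟩ := Set.not_disjoint_iff.1 hd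
    exact Or.inl ((h.subset_of_mem h' hx hx').antisymm (h'.subset_of_mem h hx' hx))

/-- Three large lobes yield a `D₃` minor. -/
theorem isMinorOf_D3 {K : Fin 3 → Set V} (h : ∀ i, IsLobe G s t (K i))
    (h2 : ∀ v, ConnSet G {x | x ≠ v}) (hst : s ≠ t) (hd : Pairwise fun i j => Disjoint (K i) (K j))
    (hK : ∀ i, (K i).Nontrivial) : IsMinorOf D3 G :=
  isMinorOf_D3_of_connSet hst (fun i => (h i).conn) (fun i => (h i).left_notMem)
    (fun i => (h i).right_notMem) hd fun i => (h i).exists_matching h2 hst (hK i)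

end IsLobe

theorem isLobe_compIn {s t x : V} (hs : x ≠ s) (ht : x ≠ t) :
    IsLobe G s t (compIn G {v | v ≠ s ∧ v ≠ t} x) where
  conn := connSet_compIn ⟨hs, ht⟩
  left_notMem h := h.1.1 rfl
  right_notMem h := h.1.2 rfl
  closed u hu v huv := by
    by_cases h1 : v = s
    · exact Or.inr (Or.inl h1)
    by_cases h2 : v = t
    · exact Or.inr (Or.inr h2)
    exact Or.inl (compIn_closed hu ⟨h1, h2⟩ huv)

/-- In a graph without `K₄` minor, if `s` and `t` are linked outside `C`, then the links through
`C` share a vertex. -/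
theorem exists_common_vertex [Finite V] (hK4 : ¬ IsMinorOf K4 G) {C S : Set V} {s t : V}
    (hC : ConnSet G C) (hS : ConnSet G S) (hsS : s ∈ S) (hSC : Disjoint S C) (htC : t ∉ C)
    (htS : t ∉ S) (hSt : ∃ v ∈ S, G.Adj t v) (hsC : ∃ u ∈ C, G.Adj s u) (htu : ∃ u ∈ C, G.Adj t u) :
    ∃ c ∈ C, ∀ K, Links G C (G.neighborSet s) (G.neighborSet t) K → c ∈ K := by
  by_contra! hc
  obtain ⟨K₁, K₂, h₁, h₂, hd⟩ := exists_disjoint_links _ C (G.neighborSet s) (G.neighborSet t) rfl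
    ⟨C, hC, subset_rfl, hsC, htu⟩ hc
  obtain ⟨x, hx⟩ := h₁.1.1
  obtain ⟨y, hy⟩ := h₂.1.1
  have hxS : x ∈ C \ K₂ := ⟨h₁.2.1 hx, Set.disjoint_left.1 hd hx⟩
  obtain ⟨u, hu, v, hv, hvS, huv⟩ := hC.exists_adj_compIn (S := C \ K₂) Set.sdiff_subset hxS
    (h₂.2.1 hy) (fun h => h.2 hy)
  have hvK : v ∈ K₂ := by
    by_contra h
    exact hvS ⟨hv, h⟩
  have hsub : K₁ ⊆ compIn G (C \ K₂) x := h₁.1.subset_compIn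
    (fun a ha => ⟨h₁.2.1 ha, Set.disjoint_left.1 hd ha⟩) hx (mem_compIn_self hxS)
  have hsub' : compIn G (C \ K₂) x ⊆ C := compIn_subset.trans Set.sdiff_subset
  obtain ⟨a₁, ha₁, sa₁⟩ := h₁.2.2.1
  obtain ⟨b₁, hb₁, tb₁⟩ := h₁.2.2.2
  obtain ⟨a₂, ha₂, sa₂⟩ := h₂.2.2.1
  obtain ⟨b₂, hb₂, tb₂⟩ := h₂.2.2.2
  refine hK4 (isMinorOf_K4 hS (.singleton t) (connSet_compIn hxS) h₂.1
    (Set.disjoint_singleton_right.2 htS) (hSC.mono_right hsub') (hSC.mono_right h₂.2.1)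
    (Set.disjoint_singleton_left.2 fun h => htC (hsub' h))
    (Set.disjoint_singleton_left.2 fun h => htC (h₂.2.1 h))
    (Set.disjoint_left.2 fun a ha => ha.1.2)
    ?_ ⟨s, hsS, a₁, hsub ha₁, sa₁⟩ ⟨s, hsS, a₂, ha₂, sa₂⟩ ⟨t, rfl, b₁, hsub hb₁, tb₁⟩
    ⟨t, rfl, b₂, hb₂, tb₂⟩ ⟨u, hu, v, hvK, huv⟩)
  obtain ⟨v, hv, htv⟩ := hSt
  exact ⟨v, hv, t, rfl, htv.symm⟩

end Minors

/-! ### Rooted decompositions of width two -/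

section JoinTree

variable {ι₁ ι₂ : Type} {T₁ : SimpleGraph ι₁} {T₂ : SimpleGraph ι₂} {r₁ : ι₁} {r₂ : ι₂}

theorem SimpleGraph.Reachable.mem_of_closed {ι : Type} {T : SimpleGraph ι} {x y : ι}
    (h : T.Reachable x y) (Z : Set ι) (hx : x ∈ Z) (hZ : ∀ u ∈ Z, ∀ v, T.Adj u v → v ∈ Z) :
    y ∈ Z := by
  obtain ⟨w⟩ := h
  induction w with
  | nil => exact hx
  | cons hadj _ ih => exact ih (hZ _ hx _ hadj)

/-- The disjoint union of two graphs together with an edge between `r₁` and `r₂`. -/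
def joinTree (T₁ : SimpleGraph ι₁) (T₂ : SimpleGraph ι₂) (r₁ : ι₁) (r₂ : ι₂) :
    SimpleGraph (ι₁ ⊕ ι₂) :=
  (T₁ ⊕g T₂) ⊔ edge (Sum.inl r₁) (Sum.inr r₂)

@[simp]
theorem joinTree_adj_inl_inl {x y : ι₁} :
    (joinTree T₁ T₂ r₁ r₂).Adj (Sum.inl x) (Sum.inl y) ↔ T₁.Adj x y := by
  simp [joinTree, edge_adj]

@[simp]
theorem joinTree_adj_inr_inr {x y : ι₂} :
    (joinTree T₁ T₂ r₁ r₂).Adj (Sum.inr x) (Sum.inr y) ↔ T₂.Adj x y := by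
  simp [joinTree, edge_adj]

@[simp]
theorem joinTree_adj_inl_inr {x : ι₁} {y : ι₂} :
    (joinTree T₁ T₂ r₁ r₂).Adj (Sum.inl x) (Sum.inr y) ↔ x = r₁ ∧ y = r₂ := by
  simp [joinTree, edge_adj]

@[simp]
theorem joinTree_adj_inr_inl {x : ι₁} {y : ι₂} :
    (joinTree T₁ T₂ r₁ r₂).Adj (Sum.inr y) (Sum.inl x) ↔ x = r₁ ∧ y = r₂ := by
  rw [adj_comm, joinTree_adj_inl_inr]

theorem isAcyclic_sum (h₁ : T₁.IsAcyclic) (h₂ : T₂.IsAcyclic) : (T₁ ⊕g T₂).IsAcyclic := by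
  rw [isAcyclic_iff_forall_adj_isBridge] at h₁ h₂ ⊢
  rintro (a | a) (b | b) hab
  · rw [sum_adj_inl] at hab
    refine isBridge_iff.2 fun hr => isBridge_iff.1 (h₁ hab) ?_
    have := hr.mem_of_closed
      {z | ∃ x, z = Sum.inl x ∧ (T₁.deleteEdges {s(a, b)}).Reachable a x}
      ⟨a, rfl, Reachable.refl _⟩ (by
        rintro _ ⟨x, rfl, hx⟩ (y | y) hxy
        · refine ⟨y, rfl, hx.trans (Adj.reachable ?_)⟩
          simp only [deleteEdges_adj, sum_adj_inl, Set.mem_singleton_iff, Sym2.eq_iff,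
            Sum.inl.injEq] at hxy ⊢
          exact hxy
        · simp at hxy)
    obtain ⟨x, hx, hr'⟩ := this
    cases hx
    exact hr'
  · simp at hab
  · simp at hab
  · rw [sum_adj_inr] at hab
    refine isBridge_iff.2 fun hr => isBridge_iff.1 (h₂ hab) ?_
    have := hr.mem_of_closed
      {z | ∃ x, z = Sum.inr x ∧ (T₂.deleteEdges {s(a, b)}).Reachable a x}
      ⟨a, rfl, Reachable.refl _⟩ (by
        rintro _ ⟨x, rfl, hx⟩ (y | y) hxy
        · simp at hxy
        · refine ⟨y, rfl, hx.trans (Adj.reachable ?_)⟩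
          simp only [deleteEdges_adj, sum_adj_inr, Set.mem_singleton_iff, Sym2.eq_iff,
            Sum.inr.injEq] at hxy ⊢
          exact hxy)
    obtain ⟨x, hx, hr'⟩ := this
    cases hx
    exact hr'

theorem isTree_joinTree (h₁ : T₁.IsTree) (h₂ : T₂.IsTree) : (joinTree T₁ T₂ r₁ r₂).IsTree := by
  refine ⟨h₁.connected.sum_sup_edge h₂.connected, ?_⟩
  exact (isAcyclic_sum h₁.isAcyclic h₂.isAcyclic).sup_edge_of_not_reachable
    (not_reachable_sum_inl_inr _ _)

end JoinTree

theorem ConnSet.image {V W : Type} {G : SimpleGraph V} {H : SimpleGraph W} {S : Set V}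
    (hS : ConnSet G S) (f : V → W) (hf : ∀ u v, G.Adj u v → H.Adj (f u) (f v)) :
    ConnSet H (f '' S) := by
  refine ⟨hS.1.image f, ?_⟩
  rintro Z ⟨_, ⟨x, hx, rfl⟩, hxZ⟩ hcl
  rw [Set.image_subset_iff]
  exact hS.2 _ ⟨x, hx, hxZ⟩ fun u hu huZ v hv huv =>
    hcl _ ⟨u, hu, rfl⟩ huZ _ ⟨v, hv, rfl⟩ (hf u v huv)

/-- `G[U]` has a spaghetti tree decomposition of width at most two with a root bag `R` such that,
in the tree, the root has at most `d v` neighbours whose bags contain `v`. -/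
def HasRootedDec {V : Type} (G : SimpleGraph V) (R U : Set V) (d : V → ℕ) : Prop :=
  ∃ (ι : Type) (_ : Finite ι) (T : SimpleGraph ι) (bag : ι → Set V) (r : ι),
    T.IsTree ∧ bag r = R ∧ (∀ x, (bag x).ncard ≤ 3) ∧ (∀ x, bag x ⊆ U) ∧
    (∀ v ∈ U, ConnSet T {x | v ∈ bag x}) ∧
    (∀ v x, v ∈ bag x → {y | v ∈ bag y ∧ T.Adj x y}.ncard ≤ 2) ∧
    (∀ v ∈ R, {y | v ∈ bag y ∧ T.Adj r y}.ncard ≤ d v) ∧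
    (∀ u ∈ U, ∀ v ∈ U, G.Adj u v → ∃ x, u ∈ bag x ∧ v ∈ bag x)

namespace HasRootedDec

variable {V : Type} {G : SimpleGraph V}

theorem base {R : Set V} (hR : R.ncard ≤ 3) (d : V → ℕ) : HasRootedDec G R R d := by
  refine ⟨Unit, inferInstance, ⊥, fun _ => R, (), IsTree.of_subsingleton, rfl, fun _ => hR,
    fun _ => subset_rfl, fun v hv => ?_, fun v x hv => by simp, fun v hv => by simp,
    fun u hu v hv _ => ⟨(), hu, hv⟩⟩
  have : {x : Unit | v ∈ R} = {()} := by ext; simp [hv]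
  rw [this]
  exact ConnSet.singleton _

theorem join {R₁ U₁ R₂ U₂ : Set V} {d₁ d₂ d : V → ℕ} (h₁ : HasRootedDec G R₁ U₁ d₁)
    (h₂ : HasRootedDec G R₂ U₂ d₂) (hU : ∀ v ∈ U₁, v ∈ U₂ → v ∈ R₁ ∧ v ∈ R₂)
    (hE : ∀ u ∈ U₁, ∀ v ∈ U₂, G.Adj u v → u ∈ U₂ ∨ v ∈ U₁)
    (hd₁ : ∀ v ∈ R₁, v ∈ R₂ → d₁ v ≤ 1) (hd₂ : ∀ v ∈ R₁, v ∈ R₂ → d₂ v ≤ 1)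
    (hd : ∀ v ∈ R₂, d₂ v ≤ d v) (hd' : ∀ v ∈ R₁, v ∈ R₂ → d₂ v + 1 ≤ d v) :
    HasRootedDec G R₂ (U₁ ∪ U₂) d := by
  obtain ⟨ι₁, _, T₁, bag₁, r₁, hT₁, hr₁, hw₁, hs₁, hc₁, hp₁, hq₁, he₁⟩ := h₁
  obtain ⟨ι₂, _, T₂, bag₂, r₂, hT₂, hr₂, hw₂, hs₂, hc₂, hp₂, hq₂, he₂⟩ := h₂
  have hset : ∀ v, {x | v ∈ Sum.elim bag₁ bag₂ x} =
      Sum.inl '' {x | v ∈ bag₁ x} ∪ Sum.inr '' {x | v ∈ bag₂ x} := by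
    intro v
    ext (x | x) <;> simp
  have hn₁ : ∀ v x, {y | v ∈ Sum.elim bag₁ bag₂ y ∧ (joinTree T₁ T₂ r₁ r₂).Adj (Sum.inl x) y} =
      Sum.inl '' {y | v ∈ bag₁ y ∧ T₁.Adj x y} ∪ {y | y = Sum.inr r₂ ∧ v ∈ R₂ ∧ x = r₁} := by
    intro v x
    ext (y | y)
    · simp
    · simp only [Set.mem_ofPred_eq, Sum.elim_inr, joinTree_adj_inl_inr, Set.mem_union,
        Set.mem_image, reduceCtorEq, and_false, exists_false, false_or, Sum.inr.injEq]
      constructor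
      · rintro ⟨h, rfl, rfl⟩
        exact ⟨rfl, hr₂ ▸ h, rfl⟩
      · rintro ⟨rfl, h, rfl⟩
        exact ⟨hr₂ ▸ h, rfl, rfl⟩
  have hn₂ : ∀ v x, {y | v ∈ Sum.elim bag₁ bag₂ y ∧ (joinTree T₁ T₂ r₁ r₂).Adj (Sum.inr x) y} =
      Sum.inr '' {y | v ∈ bag₂ y ∧ T₂.Adj x y} ∪ {y | y = Sum.inl r₁ ∧ v ∈ R₁ ∧ x = r₂} := by
    intro v x
    ext (y | y)
    · simp only [Set.mem_ofPred_eq, Sum.elim_inl, joinTree_adj_inr_inl, Set.mem_union,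
        Set.mem_image, reduceCtorEq, and_false, exists_false, false_or, Sum.inl.injEq]
      constructor
      · rintro ⟨h, rfl, rfl⟩
        exact ⟨rfl, hr₁ ▸ h, rfl⟩
      · rintro ⟨rfl, h, rfl⟩
        exact ⟨hr₁ ▸ h, rfl, rfl⟩
    · simp
  have hone : ∀ (a : ι₁ ⊕ ι₂) (P : Prop), {y | y = a ∧ P}.ncard ≤ 1 := fun a P =>
    (Set.ncard_le_ncard (fun y hy => hy.1 : {y | y = a ∧ P} ⊆ {a})).trans
      (Set.ncard_singleton a).le
  have hzero : ∀ (a : ι₁ ⊕ ι₂) (P : Prop), ¬ P → {y | y = a ∧ P}.ncard = 0 := fun a P hP => by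
    simp [hP]
  have hil : Function.Injective (Sum.inl : ι₁ → ι₁ ⊕ ι₂) := Sum.inl_injective
  have hir : Function.Injective (Sum.inr : ι₂ → ι₁ ⊕ ι₂) := Sum.inr_injective
  refine ⟨ι₁ ⊕ ι₂, inferInstance, joinTree T₁ T₂ r₁ r₂, Sum.elim bag₁ bag₂, Sum.inr r₂,
    isTree_joinTree hT₁ hT₂, hr₂, ?_, ?_, ?_, ?_, ?_, ?_⟩
  · rintro (x | x)
    · exact hw₁ x
    · exact hw₂ x
  · rintro (x | x)
    · exact (hs₁ x).trans Set.subset_union_left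
    · exact (hs₂ x).trans Set.subset_union_right
  · intro v hv
    rw [hset]
    have c₁ : v ∈ U₁ → ConnSet (joinTree T₁ T₂ r₁ r₂) (Sum.inl '' {x | v ∈ bag₁ x}) :=
      fun h => (hc₁ v h).image _ fun _ _ => joinTree_adj_inl_inl.2
    have c₂ : v ∈ U₂ → ConnSet (joinTree T₁ T₂ r₁ r₂) (Sum.inr '' {x | v ∈ bag₂ x}) :=
      fun h => (hc₂ v h).image _ fun _ _ => joinTree_adj_inr_inr.2
    by_cases h1 : v ∈ U₁
    · by_cases h2 : v ∈ U₂
      · obtain ⟨hv1, hv2⟩ := hU v h1 h2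
        exact (c₁ h1).union_of_adj (c₂ h2) (u := Sum.inl r₁) (v := Sum.inr r₂)
          ⟨r₁, (hr₁ ▸ hv1 : v ∈ bag₁ r₁), rfl⟩ ⟨r₂, (hr₂ ▸ hv2 : v ∈ bag₂ r₂), rfl⟩ (by simp)
      · have : {x | v ∈ bag₂ x} = ∅ := by
          ext x
          simpa using fun h => h2 (hs₂ x h)
        rw [this, Set.image_empty, Set.union_empty]
        exact c₁ h1
    · have h2 : v ∈ U₂ := hv.resolve_left h1
      have : {x | v ∈ bag₁ x} = ∅ := by
        ext x
        simpa using fun h => h1 (hs₁ x h)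
      rw [this, Set.image_empty, Set.empty_union]
      exact c₂ h2
  · rintro v (x | x) hv
    · rw [hn₁]
      refine (Set.ncard_union_le _ _).trans ?_
      rw [Set.ncard_image_of_injective _ hil]
      by_cases hx : v ∈ R₂ ∧ x = r₁
      · obtain ⟨hv2, rfl⟩ := hx
        have hv1 : v ∈ R₁ := hr₁ ▸ hv
        have := hq₁ v hv1
        have := hd₁ v hv1 hv2
        have := hone (Sum.inr r₂) (v ∈ R₂ ∧ x = x)
        omega
      · have := hp₁ v x hv
        have := hzero (Sum.inr r₂) _ hx
        omega
    · rw [hn₂]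
      refine (Set.ncard_union_le _ _).trans ?_
      rw [Set.ncard_image_of_injective _ hir]
      by_cases hx : v ∈ R₁ ∧ x = r₂
      · obtain ⟨hv1, rfl⟩ := hx
        have hv2 : v ∈ R₂ := hr₂ ▸ hv
        have := hq₂ v hv2
        have := hd₂ v hv1 hv2
        have := hone (Sum.inl r₁) (v ∈ R₁ ∧ x = x)
        omega
      · have := hp₂ v x hv
        have := hzero (Sum.inl r₁) _ hx
        omega
  · intro v hv2
    rw [hn₂]
    refine (Set.ncard_union_le _ _).trans ?_
    rw [Set.ncard_image_of_injective _ hir]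
    have := hq₂ v hv2
    by_cases hv1 : v ∈ R₁
    · have := hd' v hv1 hv2
      have := hone (Sum.inl r₁) (v ∈ R₁ ∧ r₂ = r₂)
      omega
    · have := hd v hv2
      have := hzero (Sum.inl r₁) (v ∈ R₁ ∧ r₂ = r₂) fun h => hv1 h.1
      omega
  · have key : ∀ u ∈ U₁ ∪ U₂, ∀ v ∈ U₁ ∪ U₂, G.Adj u v →
        (u ∈ U₁ ∧ v ∈ U₁) ∨ (u ∈ U₂ ∧ v ∈ U₂) := by
      rintro u (hu | hu) v (hv | hv) huv
      · exact Or.inl ⟨hu, hv⟩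
      · rcases hE u hu v hv huv with h | h
        · exact Or.inr ⟨h, hv⟩
        · exact Or.inl ⟨hu, h⟩
      · rcases hE v hv u hu huv.symm with h | h
        · exact Or.inr ⟨hu, h⟩
        · exact Or.inl ⟨h, hv⟩
      · exact Or.inr ⟨hu, hv⟩
    intro u hu v hv huv
    rcases key u hu v hv huv with ⟨h, h'⟩ | ⟨h, h'⟩
    · obtain ⟨x, hx⟩ := he₁ u h v h' huv
      exact ⟨Sum.inl x, hx⟩
    · obtain ⟨x, hx⟩ := he₂ u h v h' huv
      exact ⟨Sum.inr x, hx⟩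

theorem nonempty_spaghettiTD {R : Set V} {d : V → ℕ} (h : HasRootedDec G R Set.univ d) :
    ∃ td : SpaghettiTD G, ∀ x, (td.bag x).ncard ≤ 3 := by
  obtain ⟨ι, hι, T, bag, r, hT, -, hw, -, hc, hp, -, he⟩ := h
  have hconn : ∀ v, (T.induce {x | v ∈ bag x}).Connected := fun v =>
    connSet_iff.1 (hc v trivial)
  refine ⟨⟨⟨ι, hι, T, hT, bag, fun v => (hc v trivial).1,
    fun u v huv => he u trivial v trivial huv, hconn⟩, fun v => ⟨hconn v, ?_⟩⟩, hw⟩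
  exact fun x hx => hp v x hx

theorem pair_ncard_le (s t : V) : ({s, t} : Set V).ncard ≤ 3 :=
  (Set.ncard_insert_le _ _).trans (by simp)

theorem triple_ncard_le (s t c : V) : ({s, t, c} : Set V).ncard ≤ 3 :=
  (Set.ncard_insert_le _ _).trans (by
    have := Set.ncard_insert_le t {c}
    simp only [Set.ncard_singleton] at this
    omega)

/-- Two decompositions rooted at `{s, c}` and `{c, t}` combine to one rooted at `{s, t}`. -/
theorem series {s t c : V} {A B : Set V} (hst : s ≠ t) (hsc : s ≠ c) (htc : t ≠ c)
    (hA : HasRootedDec G {s, c} (A ∪ {s, c}) fun _ => 1)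
    (hB : HasRootedDec G {c, t} (B ∪ {c, t}) fun _ => 1)
    (hAB : Disjoint A B) (htA : t ∉ A) (hsB : s ∉ B)
    (hEA : ∀ u ∈ A, ∀ v, G.Adj u v → v ∈ A ∪ {s, c})
    (hEB : ∀ u ∈ B, ∀ v, G.Adj u v → v ∈ B ∪ {c, t}) :
    HasRootedDec G {s, t} (A ∪ B ∪ {s, t, c}) fun _ => 1 := by
  classical
  have hne := hAB.notMem_of_mem_left
  have h1 : HasRootedDec G {s, t, c} (A ∪ {s, c} ∪ {s, t, c}) fun v => if v = t then 0 else 1 := by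
    refine hA.join (base (triple_ncard_le s t c) fun _ => 0) ?_ ?_ ?_ ?_ ?_ ?_
    all_goals
      intro v
      have := hEA v
      grind
  have h2 : HasRootedDec G {s, t, c} (B ∪ {c, t} ∪ (A ∪ {s, c} ∪ {s, t, c}))
      fun v => if v = c then 2 else 1 := by
    refine hB.join h1 ?_ ?_ ?_ ?_ ?_ ?_
    all_goals
      intro v
      have := hEA v
      have := hEB v
      grind
  have h3 : HasRootedDec G {s, t} ((B ∪ {c, t} ∪ (A ∪ {s, c} ∪ {s, t, c})) ∪ {s, t})
      fun _ => 1 := by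
    refine h2.join (base (pair_ncard_le s t) fun _ => 0) ?_ ?_ ?_ ?_ ?_ ?_
    all_goals
      intro v
      grind
  convert h3 using 1
  ext v
  grind

/-- A vertex whose neighbours lie in the root bag `{s, t}` may be added. -/
theorem add_vertex {s t a : V} {U : Set V}
    (hU : HasRootedDec G {s, t} U fun _ => 1) (hs : s ∈ U) (ht : t ∈ U) (ha : a ∉ U)
    (hE : ∀ v, G.Adj a v → v = s ∨ v = t) :
    HasRootedDec G {s, t} (insert a U) fun _ => 1 := by
  have h1 : HasRootedDec G {s, t, a} (U ∪ {s, t, a}) fun _ => 1 := by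
    refine hU.join (base (triple_ncard_le s t a) fun _ => 0) ?_ ?_ ?_ ?_ ?_ ?_
    all_goals
      intro v
      have := fun v => G.adj_comm a v
      grind
  have h2 : HasRootedDec G {s, t} ((U ∪ {s, t, a}) ∪ {s, t}) fun _ => 1 := by
    refine h1.join (base (pair_ncard_le s t) fun _ => 0) ?_ ?_ ?_ ?_ ?_ ?_
    all_goals
      intro v
      grind
  convert h2 using 1
  ext v
  grind

/-- Two decompositions with the same root bag `{s, t}` combine. -/
theorem parallel {s t : V} {A B : Set V} (hA : HasRootedDec G {s, t} (A ∪ {s, t}) fun _ => 1)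
    (hB : HasRootedDec G {s, t} (B ∪ {s, t}) fun _ => 1) (hAB : Disjoint A B)
    (hEA : ∀ u ∈ A, ∀ v, G.Adj u v → v ∈ A ∪ {s, t}) :
    HasRootedDec G {s, t} ((A ∪ {s, t}) ∪ (B ∪ {s, t})) fun _ => 2 := by
  have hne := hAB.notMem_of_mem_left
  refine hA.join hB ?_ ?_ ?_ ?_ ?_ ?_
  all_goals
    intro v
    have := hEA v
    grind

end HasRootedDec

/-! ### Decompositions of graphs without `K₄` and `D₃` minors -/

section Construction

variable {V : Type} {G : SimpleGraph V}

theorem IsLobe.isMinorOf_D3_of_three {s t : V} {K₀ K₁ K₂ : Set V} (h₀ : IsLobe G s t K₀)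
    (h₁ : IsLobe G s t K₁) (h₂ : IsLobe G s t K₂) (h2 : ∀ v, ConnSet G {x | x ≠ v}) (hst : s ≠ t)
    (d₀₁ : Disjoint K₀ K₁) (d₀₂ : Disjoint K₀ K₂) (d₁₂ : Disjoint K₁ K₂) (n₀ : K₀.Nontrivial)
    (n₁ : K₁.Nontrivial) (n₂ : K₂.Nontrivial) : IsMinorOf D3 G := by
  refine IsLobe.isMinorOf_D3 (K := ![K₀, K₁, K₂]) ?_ h2 hst ?_ ?_
  · intro i
    fin_cases i
    exacts [h₀, h₁, h₂]
  · intro i j hij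
    fin_cases i <;> fin_cases j
    exacts [absurd rfl hij, d₀₁, d₀₂, d₀₁.symm, absurd rfl hij, d₁₂, d₀₂.symm, d₁₂.symm,
      absurd rfl hij]
  · intro i
    fin_cases i
    exacts [n₀, n₁, n₂]

/-- If `A` is a union of components of `G - {s, t}`, at most one of which is not a single vertex,
then a decomposition of that component extends to one of `A`. -/
theorem HasRootedDec.bundle [Finite V] {s t : V} (n : ℕ) : ∀ A : Set V, A.ncard = n → s ∉ A →
    t ∉ A → (∀ u ∈ A, ∀ v, G.Adj u v → v ∈ A ∪ {s, t}) →
    (∀ K K', IsLobe G s t K → IsLobe G s t K' → K ⊆ A → K' ⊆ A → K.Nontrivial → K'.Nontrivial →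
      ¬ Disjoint K K') →
    (∀ K, IsLobe G s t K → K ⊆ A → K.Nontrivial →
      HasRootedDec G {s, t} (K ∪ {s, t}) fun _ => 1) →
    HasRootedDec G {s, t} (A ∪ {s, t}) fun _ => 1 := by
  induction n with
  | zero =>
    intro A hA _ _ _ _ _
    rw [Set.ncard_eq_zero] at hA
    rw [hA, Set.empty_union]
    exact base (pair_ncard_le s t) _
  | succ n ih =>
    intro A hA hs ht hE h1 hD
    by_cases ha : ∃ a ∈ A, ∀ v, G.Adj a v → v = s ∨ v = t
    · obtain ⟨a, haA, ha⟩ := ha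
      have hsub : A \ {a} ⊆ A := Set.sdiff_subset
      have key := ih (A \ {a}) (by rw [Set.ncard_sdiff_singleton_of_mem haA, hA]; rfl)
        (fun h => hs (hsub h)) (fun h => ht (hsub h)) (by
          intro u hu v huv
          have := hE u hu.1 v huv
          have := ha u
          have := huv.symm
          grind)
        (fun K K' hK hK' hs1 hs2 => h1 K K' hK hK' (hs1.trans hsub) (hs2.trans hsub))
        (fun K hK hs1 => hD K hK (hs1.trans hsub))
      have := key.add_vertex (a := a) (by simp) (by simp) (by
        rintro (h | rfl | rfl)
        exacts [h.2 rfl, hs haA, ht haA]) ha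
      convert this using 1
      ext v
      grind
    · push Not at ha
      have hlobe : ∀ x ∈ A, IsLobe G s t (compIn G {v | v ≠ s ∧ v ≠ t} x) ∧
          compIn G {v | v ≠ s ∧ v ≠ t} x ⊆ A ∧ (compIn G {v | v ≠ s ∧ v ≠ t} x).Nontrivial ∧
          x ∈ compIn G {v | v ≠ s ∧ v ≠ t} x := by
        intro x hx
        have hxs : x ≠ s := fun h => hs (h ▸ hx)
        have hxt : x ≠ t := fun h => ht (h ▸ hx)
        have hL := isLobe_compIn (G := G) hxs hxt
        have hm : x ∈ compIn G {v | v ≠ s ∧ v ≠ t} x := mem_compIn_self ⟨hxs, hxt⟩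
        refine ⟨hL, hL.conn.2 A ⟨x, hm, hx⟩ ?_, ?_, hm⟩
        · intro u _ huA v hv huv
          rcases hE u huA v huv with h | rfl | rfl
          exacts [h, absurd hv hL.left_notMem, absurd hv hL.right_notMem]
        · obtain ⟨v, hxv, hvs, hvt⟩ := ha x hx
          exact ⟨x, hm, v, compIn_closed hm ⟨hvs, hvt⟩ hxv, hxv.ne⟩
      obtain ⟨x, hx⟩ : A.Nonempty := Set.nonempty_of_ncard_ne_zero (by omega)
      obtain ⟨hL, hLA, hLn, -⟩ := hlobe x hx
      have hAL : A ⊆ compIn G {v | v ≠ s ∧ v ≠ t} x := by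
        intro y hy
        obtain ⟨hL', hLA', hLn', hyL'⟩ := hlobe y hy
        rcases hL.eq_or_disjoint hL' with h | h
        · rw [h]
          exact hyL'
        · exact absurd h (h1 _ _ hL hL' hLA hLA' hLn hLn')
      rw [hAL.antisymm hLA]
      exact hD _ hL hLA hLn

theorem IsLobe.hasRootedDec [Finite V] (hK4 : ¬ IsMinorOf K4 G) (hD3 : ¬ IsMinorOf D3 G)
    (h2 : ∀ v, ConnSet G {x | x ≠ v}) (n : ℕ) : ∀ (C : Set V) (s t o : V), C.ncard = n →
    IsLobe G s t C → s ≠ t → o ∉ C → o ≠ s → o ≠ t →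
    HasRootedDec G {s, t} (C ∪ {s, t}) fun _ => 1 := by
  induction n using Nat.strong_induction_on with
  | _ n ih =>
  intro C s t o hn hC hst hoC hos hot
  set O := compIn G {v | v ≠ s ∧ v ≠ t} o with hO
  have hOL : IsLobe G s t O := isLobe_compIn hos hot
  have hoO : o ∈ O := mem_compIn_self ⟨hos, hot⟩
  have hOC : Disjoint O C := (hOL.eq_or_disjoint hC).resolve_left fun h => hoC (h ▸ hoO)
  obtain ⟨os, hosO, hsos⟩ := hOL.exists_adj_left h2 hst
  obtain ⟨ot, hotO, htot⟩ := hOL.exists_adj_right h2 hst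
  obtain ⟨c, hcC, hc⟩ := exists_common_vertex hK4 hC.conn (hOL.conn.insert_of_adj hosO hsos.symm)
    (Set.mem_insert _ _) (Set.disjoint_insert_left.2 ⟨hC.left_notMem, hOC⟩) hC.right_notMem
    (by
      rintro (h | h)
      exacts [hst h.symm, hOL.right_notMem h])
    ⟨ot, Or.inr hotO, htot⟩ (hC.exists_adj_left h2 hst) (hC.exists_adj_right h2 hst)
  have side : ∀ p q o' X, p ∉ C → q ∉ C → p ≠ q → G.Adj q o' → o' ∉ C → o' ≠ p → X ⊆ C → c ∉ X →
      (∀ u ∈ X, ∀ v, G.Adj u v → v ∈ X ∪ {p, c}) →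
      HasRootedDec G {p, c} (X ∪ {p, c}) fun _ => 1 := by
    intro p q o' X hp hq hpq hqo ho' hop hXC hcX hE
    have hpc : p ≠ c := fun h => hp (h ▸ hcC)
    have hqc : q ≠ c := fun h => hq (h ▸ hcC)
    have hoc : o' ≠ c := fun h => ho' (h ▸ hcC)
    refine HasRootedDec.bundle _ X rfl (fun h => hp (hXC h)) hcX hE ?_ ?_
    · intro K K' hK hK' hKX hKX' hn hn' hd
      have hL : IsLobe G p c (compIn G {v | v ≠ p ∧ v ≠ c} q) := isLobe_compIn hpq.symm hqc
      have hqL : q ∈ compIn G {v | v ≠ p ∧ v ≠ c} q := mem_compIn_self ⟨hpq.symm, hqc⟩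
      have hdis : ∀ K, IsLobe G p c K → K ⊆ X → Disjoint K (compIn G {v | v ≠ p ∧ v ≠ c} q) :=
        fun K hK hKX => (hK.eq_or_disjoint hL).resolve_left fun h => hq (hXC (hKX (h ▸ hqL)))
      exact hD3 (hK.isMinorOf_D3_of_three hK' hL h2 hpc hd (hdis K hK hKX) (hdis K' hK' hKX') hn hn'
        ⟨q, hqL, o', compIn_closed hqL ⟨hop, hoc⟩ hqo, hqo.ne⟩)
    · intro K hK hKX _
      refine ih _ ?_ K p c q rfl hK hpc (fun h => hq (hXC (hKX h))) hpq.symm hqc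
      rw [← hn]
      exact Set.ncard_lt_ncard ((Set.ssubset_iff_of_subset (hKX.trans hXC)).2
        ⟨c, hcC, hK.right_notMem⟩)
  set A := {x | x ∈ C ∧ x ≠ c ∧ ∃ u ∈ compIn G (C \ {c}) x, G.Adj s u} with hA
  set B := {x | x ∈ C ∧ x ≠ c ∧ ¬ ∃ u ∈ compIn G (C \ {c}) x, G.Adj s u} with hB
  have hstep : ∀ u v, u ∈ A → v ∈ C → v ≠ c → G.Adj u v → v ∈ A := by
    rintro u v ⟨huC, huc, w, hw, hsw⟩ hv hvc huv
    have hum : u ∈ compIn G (C \ {c}) u := mem_compIn_self ⟨huC, huc⟩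
    have hcu : ConnSet G (compIn G (C \ {c}) u) := connSet_compIn ⟨huC, huc⟩
    exact ⟨hv, hvc, w, hcu.subset_compIn compIn_subset
      (compIn_closed hum ⟨hv, hvc⟩ huv) (mem_compIn_self ⟨hv, hvc⟩) hw, hsw⟩
  have hEA : ∀ u ∈ A, ∀ v, G.Adj u v → v ∈ A ∪ {s, c} := by
    intro u hu v huv
    obtain ⟨huC, huc, w, hw, hsw⟩ := id hu
    have hum : u ∈ compIn G (C \ {c}) u := mem_compIn_self ⟨huC, huc⟩
    by_cases hvc : v = c
    · exact Or.inr (Or.inr hvc)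
    rcases hC.closed u huC v huv with h | h | rfl
    · exact Or.inl (hstep u v hu h hvc huv)
    · exact Or.inr (Or.inl h)
    · have hcu := hc (compIn G (C \ {c}) u) ⟨connSet_compIn ⟨huC, huc⟩,
        compIn_subset.trans Set.sdiff_subset, ⟨w, hw, hsw⟩, ⟨u, hum, huv.symm⟩⟩
      exact absurd rfl (compIn_subset hcu).2
  have hEB : ∀ u ∈ B, ∀ v, G.Adj u v → v ∈ B ∪ {t, c} := by
    intro u hu v huv
    obtain ⟨huC, huc, hw⟩ := id hu
    have hum : u ∈ compIn G (C \ {c}) u := mem_compIn_self ⟨huC, huc⟩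
    by_cases hvc : v = c
    · exact Or.inr (Or.inr hvc)
    rcases hC.closed u huC v huv with h | rfl | h
    · exact Or.inl ⟨h, hvc, fun h' => hw (hstep v u ⟨h, hvc, h'⟩ huC huc huv.symm).2.2⟩
    · exact absurd ⟨u, hum, huv.symm⟩ hw
    · exact Or.inr (Or.inl h)
  have hAC : A ⊆ C := fun x hx => hx.1
  have hBC : B ⊆ C := fun x hx => hx.1
  have dA := side s t ot A hC.left_notMem hC.right_notMem hst htot (hOC.notMem_of_mem_left hotO)
    (fun h => hOL.left_notMem (h ▸ hotO)) hAC (fun h => h.2.1 rfl) hEA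
  have dB := side t s os B hC.right_notMem hC.left_notMem hst.symm hsos
    (hOC.notMem_of_mem_left hosO) (fun h => hOL.right_notMem (h ▸ hosO)) hBC
    (fun h => h.2.1 rfl) hEB
  rw [Set.pair_comm t c] at dB hEB
  have := HasRootedDec.series hst (fun h => hC.left_notMem (h ▸ hcC))
    (fun h => hC.right_notMem (h ▸ hcC)) dA dB
    (Set.disjoint_left.2 fun x hx hx' => hx'.2.2 hx.2.2) (fun h => hC.right_notMem (hAC h))
    (fun h => hC.left_notMem (hBC h)) hEA hEB
  convert this using 1
  ext v
  simp only [hA, hB, Set.mem_union, Set.mem_insert_iff, Set.mem_singleton_iff, Set.mem_ofPred_eq]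
  grind

theorem exists_isLobe_of_four_le [Finite V] (hK4 : ¬ IsMinorOf K4 G)
    (h2 : ∀ v, ConnSet G {x | x ≠ v}) (hV : 4 ≤ Nat.card V) :
    ∃ s t K o, s ≠ t ∧ IsLobe G s t K ∧ o ∉ K ∧ o ≠ s ∧ o ≠ t := by
  have hex : ∀ a b c : V, ∃ x, x ≠ a ∧ x ≠ b ∧ x ≠ c := by
    intro a b c
    by_contra! h
    have : (Set.univ : Set V) ⊆ {a, b, c} := by
      intro x _
      have := h x
      grind
    have := (Set.ncard_le_ncard this).trans (HasRootedDec.triple_ncard_le a b c)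
    rw [Set.ncard_univ] at this
    omega
  obtain ⟨v₀⟩ : Nonempty V := (Nat.card_pos_iff.1 (by omega)).1
  obtain ⟨x, hx, -⟩ := hex v₀ v₀ v₀
  obtain ⟨y, hy, hyx, -⟩ := hex v₀ x x
  obtain ⟨s, -, -, t, -, -, hst⟩ := (h2 v₀).exists_exit {x} hx rfl hy hyx
  obtain ⟨w, hws, hwt, -⟩ := hex s t t
  have hL := isLobe_compIn (G := G) hws hwt
  by_cases ho : ∃ o, o ∉ compIn G {v | v ≠ s ∧ v ≠ t} w ∧ o ≠ s ∧ o ≠ t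
  · obtain ⟨o, ho⟩ := ho
    exact ⟨s, t, _, o, hst.ne, hL, ho⟩
  push Not at ho
  generalize compIn G {v | v ≠ s ∧ v ≠ t} w = K at hL ho
  obtain ⟨c, hcK, hc⟩ := exists_common_vertex hK4 hL.conn (.singleton s) rfl
    (Set.disjoint_singleton_left.2 hL.left_notMem) hL.right_notMem hst.ne.symm ⟨s, rfl, hst.symm⟩
    (hL.exists_adj_left h2 hst.ne) (hL.exists_adj_right h2 hst.ne)
  obtain ⟨a, has, hat, hac⟩ := hex s t c
  have haK : a ∈ K := by
    by_contra h
    exact hat (ho a h has)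
  have hconn : ConnSet G (compIn G (K \ {c}) a) := connSet_compIn ⟨haK, hac⟩
  have hsub : compIn G (K \ {c}) a ⊆ K := compIn_subset.trans Set.sdiff_subset
  have hcn : c ∉ compIn G (K \ {c}) a := fun h => (compIn_subset h).2 rfl
  have hsn : s ∉ compIn G (K \ {c}) a := fun h => hL.left_notMem (hsub h)
  have htn : t ∉ compIn G (K \ {c}) a := fun h => hL.right_notMem (hsub h)
  have hcl : ∀ u ∈ compIn G (K \ {c}) a, ∀ v, G.Adj u v →
      v ∈ compIn G (K \ {c}) a ∨ v = c ∨ v = s ∨ v = t := by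
    intro u hu v huv
    by_cases hvc : v = c
    · exact Or.inr (Or.inl hvc)
    rcases hL.closed u (hsub hu) v huv with h | h
    · exact Or.inl (compIn_closed hu ⟨h, hvc⟩ huv)
    · exact Or.inr (Or.inr h)
  have hsc : s ≠ c := fun h => hL.left_notMem (h ▸ hcK)
  have htc : t ≠ c := fun h => hL.right_notMem (h ▸ hcK)
  by_cases ht : ∃ u ∈ compIn G (K \ {c}) a, G.Adj t u
  · refine ⟨t, c, _, s, htc, ⟨hconn, htn, hcn, fun u hu v huv => ?_⟩, hsn, hst.ne, hsc⟩
    rcases hcl u hu v huv with h | h | rfl | h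
    · exact Or.inl h
    · exact Or.inr (Or.inr h)
    · exact absurd (hc _ ⟨hconn, hsub, ⟨u, hu, huv.symm⟩, ht⟩) hcn
    · exact Or.inr (Or.inl h)
  · refine ⟨s, c, _, t, hsc, ⟨hconn, hsn, hcn, fun u hu v huv => ?_⟩, htn, hst.ne.symm, htc⟩
    rcases hcl u hu v huv with h | h | h | rfl
    · exact Or.inl h
    · exact Or.inr (Or.inr h)
    · exact Or.inr (Or.inl h)
    · exact absurd ⟨u, hu, huv.symm⟩ ht

theorem exists_spaghettiTD [Finite V] (hK4 : ¬ IsMinorOf K4 G) (hD3 : ¬ IsMinorOf D3 G)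
    (h2 : ∀ v, ConnSet G {x | x ≠ v}) :
    ∃ td : SpaghettiTD G, ∀ x, (td.bag x).ncard ≤ 3 := by
  by_cases hV : 4 ≤ Nat.card V
  swap
  · refine (HasRootedDec.base (R := Set.univ) ?_ fun _ => 0).nonempty_spaghettiTD
    rw [Set.ncard_univ]
    omega
  obtain ⟨s, t, K, o, hst, hK, hoK, hos, hot⟩ := exists_isLobe_of_four_le hK4 h2 hV
  by_cases hfat : ∃ C, IsLobe G s t C ∧ C.Nontrivial
  · obtain ⟨C, hC, hCn⟩ := hfat
    obtain ⟨o', ho'C, ho's, ho't⟩ : ∃ o', o' ∉ C ∧ o' ≠ s ∧ o' ≠ t := by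
      rcases hC.eq_or_disjoint hK with rfl | h
      · exact ⟨o, hoK, hos, hot⟩
      · obtain ⟨k, hk⟩ := hK.conn.1
        exact ⟨k, h.notMem_of_mem_right hk, fun e => hK.left_notMem (e ▸ hk),
          fun e => hK.right_notMem (e ▸ hk)⟩
    obtain ⟨z, hz⟩ := hC.conn.1
    have hzs : z ≠ s := fun e => hC.left_notMem (e ▸ hz)
    have hzt : z ≠ t := fun e => hC.right_notMem (e ▸ hz)
    have dC := IsLobe.hasRootedDec hK4 hD3 h2 _ C s t o' rfl hC hst ho'C ho's ho't
    have hdis : Disjoint C {v | v ∉ C ∧ v ≠ s ∧ v ≠ t} :=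
      Set.disjoint_left.2 fun x hx hx' => hx'.1 hx
    have dA : HasRootedDec G {s, t} ({v | v ∉ C ∧ v ≠ s ∧ v ≠ t} ∪ {s, t}) fun _ => 1 := by
      refine HasRootedDec.bundle _ _ rfl (fun h => h.2.1 rfl) (fun h => h.2.2 rfl) ?_ ?_ ?_
      · rintro u ⟨hu, hus, hut⟩ v huv
        by_cases hvs : v = s
        · exact Or.inr (Or.inl hvs)
        by_cases hvt : v = t
        · exact Or.inr (Or.inr hvt)
        refine Or.inl ⟨fun hv => ?_, hvs, hvt⟩
        rcases hC.closed v hv u huv.symm with h | h | h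
        exacts [hu h, hus h, hut h]
      · intro K₁ K₂ h₁ h₂ hs₁ hs₂ hn₁ hn₂ hd
        exact hD3 (hC.isMinorOf_D3_of_three h₁ h₂ h2 hst (hdis.mono_right hs₁)
          (hdis.mono_right hs₂) hd hCn hn₁ hn₂)
      · intro K₁ h₁ hs₁ _
        exact IsLobe.hasRootedDec hK4 hD3 h2 _ K₁ s t z rfl h₁ hst (fun h => (hs₁ h).1 hz) hzs hzt
    have := dC.parallel dA hdis fun u hu v huv => hC.closed u hu v huv
    refine HasRootedDec.nonempty_spaghettiTD (R := {s, t}) (d := fun _ => 2) ?_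
    convert this using 1
    ext v
    simp only [Set.mem_union, Set.mem_insert_iff, Set.mem_singleton_iff, Set.mem_ofPred_eq,
      Set.mem_univ, true_iff]
    tauto
  · push Not at hfat
    have dA : HasRootedDec G {s, t} ({v | v ≠ s ∧ v ≠ t} ∪ {s, t}) fun _ => 1 := by
      refine HasRootedDec.bundle _ _ rfl (fun h => h.1 rfl) (fun h => h.2 rfl) ?_ ?_ ?_
      · rintro u - v -
        simp only [Set.mem_union, Set.mem_insert_iff, Set.mem_singleton_iff, Set.mem_ofPred_eq]
        tauto
      · exact fun K₁ _ h₁ _ _ _ hn _ _ => Set.not_nontrivial_iff.2 (hfat K₁ h₁) hn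
      · exact fun K₁ h₁ _ hn => absurd hn (Set.not_nontrivial_iff.2 (hfat K₁ h₁))
    refine HasRootedDec.nonempty_spaghettiTD (R := {s, t}) (d := fun _ => 1) ?_
    convert dA using 1
    ext v
    simp only [Set.mem_union, Set.mem_insert_iff, Set.mem_singleton_iff, Set.mem_ofPred_eq,
      Set.mem_univ, true_iff]
    tauto

end Construction

/-! ### Convex sets of nodes of a tree -/

section TreeConvex

variable {ι : Type} {T : SimpleGraph ι}

/-- The nodes on the side of `p` after deleting the edge `pp'`. -/
def treeSide (T : SimpleGraph ι) (p p' : ι) : Set ι :=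
  {x | (T.deleteEdges {s(p, p')}).Reachable p x}

theorem left_mem_treeSide (p p' : ι) : p ∈ treeSide T p p' := Reachable.refl _

theorem right_notMem_treeSide (hT : T.IsAcyclic) {p p' : ι} (h : T.Adj p p') :
    p' ∉ treeSide T p p' :=
  isBridge_iff.1 (isAcyclic_iff_forall_adj_isBridge.1 hT h)

theorem eq_of_adj_treeSide {p p' x y : ι} (hx : x ∈ treeSide T p p') (hy : y ∉ treeSide T p p')
    (hxy : T.Adj x y) : x = p ∧ y = p' := by
  by_contra hne
  refine hy (Reachable.trans hx (Adj.reachable ?_))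
  rw [deleteEdges_adj]
  refine ⟨hxy, fun h => ?_⟩
  rw [Set.mem_singleton_iff, Sym2.eq_iff] at h
  rcases h with h | ⟨-, rfl⟩
  · exact hne h
  · exact hy (left_mem_treeSide _ _)

theorem notMem_treeSide_of_walk_of_notMem {p p' x y : ι} (w : T.Walk x y) (hw : p ∉ w.support)
    (hx : x ∉ treeSide T p p') : y ∉ treeSide T p p' := by
  induction w with
  | nil => exact hx
  | @cons a b c hab w ih =>
    rw [Walk.support_cons, List.mem_cons, not_or] at hw
    refine ih hw.2 fun hb => hw.2 ?_
    rw [← (eq_of_adj_treeSide hb hx hab.symm).1]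
    exact w.start_mem_support

theorem notMem_treeSide_of_walk (hT : T.IsAcyclic) {p p' y : ι} (h : T.Adj p p')
    (w : T.Walk p' y) (hw : p ∉ w.support) : y ∉ treeSide T p p' :=
  notMem_treeSide_of_walk_of_notMem w hw (right_notMem_treeSide hT h)

/-- A set of nodes containing both ends of every edge separating two of its members. -/
def TreeConvex (T : SimpleGraph ι) (S : Set ι) : Prop :=
  ∀ p p', T.Adj p p' → (∃ x ∈ S, x ∈ treeSide T p p') → (∃ y ∈ S, y ∉ treeSide T p p') →
    p ∈ S ∧ p' ∈ S

theorem ConnSet.treeConvex {S : Set ι} (hS : ConnSet T S) : TreeConvex T S := by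
  rintro p p' - ⟨x, hx, hxs⟩ ⟨y, hy, hys⟩
  obtain ⟨u, hu, hus, v, hv, hvs, huv⟩ := hS.exists_exit _ hx hxs hy hys
  obtain ⟨rfl, rfl⟩ := eq_of_adj_treeSide hus hvs huv
  exact ⟨hu, hv⟩

theorem TreeConvex.inter {S S' : Set ι} (hS : TreeConvex T S) (hS' : TreeConvex T S') :
    TreeConvex T (S ∩ S') := by
  rintro p p' h ⟨x, hx, hxs⟩ ⟨y, hy, hys⟩
  obtain ⟨h1, h2⟩ := hS p p' h ⟨x, hx.1, hxs⟩ ⟨y, hy.1, hys⟩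
  obtain ⟨h3, h4⟩ := hS' p p' h ⟨x, hx.2, hxs⟩ ⟨y, hy.2, hys⟩
  exact ⟨⟨h1, h3⟩, h2, h4⟩

theorem TreeConvex.mem_of_walk (hT : T.IsAcyclic) {S Z : Set ι} (hS : TreeConvex T S)
    (hZ : ∀ u ∈ S, u ∈ Z → ∀ v ∈ S, T.Adj u v → v ∈ Z) {x y : ι} (w : T.Walk x y)
    (hw : w.IsPath) (hx : x ∈ S) (hxZ : x ∈ Z) (hy : y ∈ S) : y ∈ Z := by
  induction w with
  | nil => exact hxZ
  | @cons a b c hab w ih =>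
    rw [Walk.cons_isPath_iff] at hw
    have hb := (hS a b hab ⟨a, hx, left_mem_treeSide _ _⟩
      ⟨c, hy, notMem_treeSide_of_walk hT hab w hw.2⟩).2
    exact ih hw.1 hb (hZ a hx hxZ b hb hab) hy

theorem TreeConvex.connSet (hT : T.IsTree) {S : Set ι} (hS : TreeConvex T S) (hne : S.Nonempty) :
    ConnSet T S := by
  refine ⟨hne, fun Z ⟨x, hx, hxZ⟩ hZ y hy => ?_⟩
  obtain ⟨w, hw⟩ := (hT.connected x y).exists_isPath
  exact hS.mem_of_walk hT.isAcyclic hZ w hw hx hxZ hy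

theorem TreeConvex.helly_of_walk (hT : T.IsAcyclic) {A B C : Set ι} (hA : TreeConvex T A)
    (hB : TreeConvex T B) (hC : TreeConvex T C) (hBC : (B ∩ C).Nonempty) {p q : ι}
    (w : T.Walk p q) (hw : w.IsPath) (hp : p ∈ A ∩ B) (hq : q ∈ A ∩ C) :
    (A ∩ B ∩ C).Nonempty := by
  induction w with
  | nil => exact ⟨_, hp, hq.2⟩
  | @cons a b c hab w ih =>
    rw [Walk.cons_isPath_iff] at hw
    have hc := notMem_treeSide_of_walk hT hab w hw.2
    have ha := left_mem_treeSide (T := T) a b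
    obtain ⟨r, hrB, hrC⟩ := hBC
    by_cases hr : r ∈ treeSide T a b
    · exact ⟨a, hp, (hC a b hab ⟨r, hrC, hr⟩ ⟨c, hq.2, hc⟩).1⟩
    · exact ih hw.1 ⟨(hA a b hab ⟨a, hp.1, ha⟩ ⟨c, hq.1, hc⟩).2,
        (hB a b hab ⟨a, hp.2, ha⟩ ⟨r, hrB, hr⟩).2⟩ hq

theorem TreeConvex.helly (hT : T.IsTree) {A B C : Set ι} (hA : TreeConvex T A)
    (hB : TreeConvex T B) (hC : TreeConvex T C) (hAB : (A ∩ B).Nonempty) (hAC : (A ∩ C).Nonempty)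
    (hBC : (B ∩ C).Nonempty) : (A ∩ B ∩ C).Nonempty := by
  obtain ⟨p, hp⟩ := hAB
  obtain ⟨q, hq⟩ := hAC
  obtain ⟨w, hw⟩ := (hT.connected p q).exists_isPath
  exact hA.helly_of_walk hT.isAcyclic hB hC hBC w hw hp hq

theorem exists_exit_edge_of_walk (hT : T.IsAcyclic) {S : Set ι} {x y : ι} (w : T.Walk x y)
    (hw : w.IsPath) (hx : x ∈ S) (hy : y ∉ S) :
    ∃ z z', T.Adj z z' ∧ z ∈ S ∧ z' ∉ S ∧ y ∉ treeSide T z z' := by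
  induction w with
  | nil => exact absurd hx hy
  | @cons a b c hab w ih =>
    rw [Walk.cons_isPath_iff] at hw
    by_cases hb : b ∈ S
    · exact ih hw.1 hb hy
    · exact ⟨a, b, hab, hx, hb, notMem_treeSide_of_walk hT hab w hw.2⟩

/-- A convex set is left along an edge separating all of it from a given node outside. -/
theorem TreeConvex.exists_exit_edge (hT : T.IsTree) {S : Set ι} (hS : TreeConvex T S) {x y : ι}
    (hx : x ∈ S) (hy : y ∉ S) :
    ∃ z z', T.Adj z z' ∧ z ∈ S ∧ z' ∉ S ∧ y ∉ treeSide T z z' ∧ S ⊆ treeSide T z z' := by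
  obtain ⟨w, hw⟩ := (hT.connected x y).exists_isPath
  obtain ⟨z, z', h, hz, hz', hyz⟩ := exists_exit_edge_of_walk hT.isAcyclic w hw hx hy
  refine ⟨z, z', h, hz, hz', hyz, fun v hv => ?_⟩
  by_contra hvs
  exact hz' (hS z z' h ⟨z, hz, left_mem_treeSide _ _⟩ ⟨v, hv, hvs⟩).2

end TreeConvex

theorem SimpleGraph.Connected.false_of_three_ends {α : Type} [Finite α] {H : SimpleGraph α}
    (hH : H.Connected) (h2 : ∀ x, (H.neighborSet x).ncard ≤ 2) (z : Fin 3 → α)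
    (hz : Function.Injective z) (h1 : ∀ i, (H.neighborSet (z i)).ncard ≤ 1) : False := by
  classical
  have := Fintype.ofFinite α
  have hdeg : ∀ x, H.degree x + (if x ∈ Finset.univ.image z then 1 else 0) ≤ 2 := by
    intro x
    have hx : H.degree x = (H.neighborSet x).ncard := by
      rw [Set.ncard_eq_toFinset_card', ← card_neighborFinset_eq_degree, neighborFinset]
    split_ifs with h
    · obtain ⟨i, -, rfl⟩ := Finset.mem_image.1 h
      have := h1 i
      omega
    · have := h2 x
      omega
  have hsum := Finset.sum_le_sum fun x (_ : x ∈ Finset.univ) => hdeg x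
  rw [Finset.sum_add_distrib, sum_degrees_eq_twice_card_edges, Finset.sum_ite_mem,
    Finset.univ_inter, Finset.sum_const, Finset.sum_const,
    Finset.card_image_of_injective _ hz] at hsum
  have := hH.card_vert_le_card_edgeSet_add_one
  rw [Nat.card_eq_fintype_card, Nat.card_eq_fintype_card, ← edgeFinset_card] at this
  simp only [Finset.card_univ, Fintype.card_fin, smul_eq_mul] at hsum
  omega

/-! ### Models of `D₃` -/

section Model

variable {V : Type} {G : SimpleGraph V}

/-- `L` is empty if `p = a`, and otherwise a connected set containing `p` and adjacent to `a`. -/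
def IsLeg (G : SimpleGraph V) (a p : V) (L : Set V) : Prop :=
  (p = a ∧ L = ∅) ∨ (ConnSet G L ∧ p ∈ L ∧ ∃ u ∈ L, G.Adj a u)

theorem IsLeg.union {a p x : V} {L X : Set V} (h : IsLeg G a p L) (hX : ConnSet G X) (hx : x ∈ X)
    (hpx : G.Adj p x) : ConnSet G (L ∪ X) ∧ ∃ u ∈ L ∪ X, G.Adj a u := by
  rcases h with ⟨rfl, rfl⟩ | ⟨hL, hpL, u, hu, hau⟩
  · rw [Set.empty_union]
    exact ⟨hX, x, hx, hpx⟩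
  · exact ⟨hL.union_of_adj hX hpL hx hpx, u, Or.inl hu, hau⟩

theorem IsLeg.insert {a p v : V} {L : Set V} (h : IsLeg G a p L) (hpv : G.Adj p v) :
    IsLeg G a v (insert v L) := by
  refine Or.inr ?_
  rcases h with ⟨rfl, rfl⟩ | ⟨hL, hpL, u, hu, hau⟩
  · rw [insert_empty_eq]
    exact ⟨.singleton v, rfl, v, rfl, hpv⟩
  · exact ⟨hL.insert_of_adj hpL hpv, Or.inl rfl, u, Or.inr hu, hau⟩

/-- In a connected set, three vertices are joined to a common centre by disjoint legs. -/
theorem exists_tripod [Finite V] (n : ℕ) : ∀ (A : Set V) (p q r : V), A.ncard = n → ConnSet G A →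
    p ∈ A → q ∈ A → r ∈ A → ∃ a ∈ A, ∃ P Q R : Set V, P ⊆ A \ {a} ∧ Q ⊆ A \ {a} ∧ R ⊆ A \ {a} ∧
      Disjoint P Q ∧ Disjoint P R ∧ Disjoint Q R ∧ IsLeg G a p P ∧ IsLeg G a q Q ∧
      IsLeg G a r R := by
  induction n using Nat.strong_induction_on with
  | _ n ih =>
  classical
  intro A p q r hn hA hp hq hr
  have hleg : ∀ x ∈ A, x ≠ p → IsLeg G p x (compIn G (A \ {p}) x) := by
    intro x hx hxp
    have hxA : x ∈ A \ {p} := ⟨hx, hxp⟩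
    obtain ⟨u, hu, v, hv, hvA, huv⟩ := hA.exists_adj_compIn Set.sdiff_subset hxA hp
      fun h => h.2 rfl
    have hvp : v = p := by
      by_contra h
      exact hvA ⟨hv, h⟩
    exact Or.inr ⟨connSet_compIn hxA, mem_compIn_self hxA, u, hu, hvp ▸ huv.symm⟩
  by_cases hqp : q = p
  · refine ⟨p, hp, ∅, ∅, if r = p then ∅ else compIn G (A \ {p}) r, Set.empty_subset _,
      Set.empty_subset _, ?_, Set.disjoint_empty _, Set.empty_disjoint _, Set.empty_disjoint _,
      Or.inl ⟨rfl, rfl⟩, Or.inl ⟨hqp, rfl⟩, ?_⟩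
    · split_ifs
      exacts [Set.empty_subset _, compIn_subset]
    · split_ifs with h
      exacts [Or.inl ⟨h, rfl⟩, hleg r hr h]
  by_cases hrp : r = p
  · exact ⟨p, hp, ∅, compIn G (A \ {p}) q, ∅, Set.empty_subset _, compIn_subset,
      Set.empty_subset _, Set.empty_disjoint _, Set.empty_disjoint _, Set.disjoint_empty _,
      Or.inl ⟨rfl, rfl⟩, hleg q hq hqp, Or.inl ⟨hrp, rfl⟩⟩
  by_cases hd : Disjoint (compIn G (A \ {p}) q) (compIn G (A \ {p}) r)
  · exact ⟨p, hp, ∅, compIn G (A \ {p}) q, compIn G (A \ {p}) r, Set.empty_subset _, compIn_subset,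
      compIn_subset, Set.empty_disjoint _, Set.empty_disjoint _, hd, Or.inl ⟨rfl, rfl⟩,
      hleg q hq hqp, hleg r hr hrp⟩
  obtain ⟨x, hxq, hxr⟩ := Set.not_disjoint_iff.1 hd
  have hK : ConnSet G (compIn G (A \ {p}) q) := connSet_compIn ⟨hq, hqp⟩
  have hKr : ConnSet G (compIn G (A \ {p}) r) := connSet_compIn ⟨hr, hrp⟩
  have hrK : r ∈ compIn G (A \ {p}) q := hKr.subset_compIn compIn_subset hxr hxq
    (mem_compIn_self ⟨hr, hrp⟩)
  have hqK : q ∈ compIn G (A \ {p}) q := mem_compIn_self ⟨hq, hqp⟩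
  obtain ⟨-, -, v, hv, hpv⟩ := (hleg q hq hqp).resolve_left fun h => hqp h.1
  have hKA : compIn G (A \ {p}) q ⊆ A \ {p} := compIn_subset
  generalize compIn G (A \ {p}) q = K at hK hrK hqK hv hKA
  have hKA' : K ⊆ A := hKA.trans Set.sdiff_subset
  have hpK : p ∉ K := fun h => (hKA h).2 rfl
  obtain ⟨a, ha, P, Q, R, hP, hQ, hR, dPQ, dPR, dQR, lP, lQ, lR⟩ := ih _
    (hn ▸ Set.ncard_lt_ncard ((Set.ssubset_iff_of_subset hKA').2 ⟨p, hp, hpK⟩)) K v q r rfl hK hv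
    hqK hrK
  have hsub : ∀ L, L ⊆ K \ {a} → L ⊆ A \ {a} ∧ p ∉ L := fun L hL =>
    ⟨fun y hy => ⟨hKA' (hL hy).1, (hL hy).2⟩, fun h => hpK (hL h).1⟩
  exact ⟨a, hKA' ha, insert p P, Q, R,
    Set.insert_subset ⟨hp, fun h => hpK ((h : p = a) ▸ ha)⟩ (hsub P hP).1, (hsub Q hQ).1,
    (hsub R hR).1, Set.disjoint_insert_left.2 ⟨(hsub Q hQ).2, dPQ⟩,
    Set.disjoint_insert_left.2 ⟨(hsub R hR).2, dPR⟩, dQR, lP.insert hpv.symm, lQ, lR⟩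

theorem exists_tripod_fin [Finite V] {A : Set V} (hA : ConnSet G A) (p : Fin 3 → V)
    (hp : ∀ i, p i ∈ A) : ∃ a ∈ A, ∃ L : Fin 3 → Set V, (∀ i, L i ⊆ A \ {a}) ∧
      (Pairwise fun i j => Disjoint (L i) (L j)) ∧ ∀ i, IsLeg G a (p i) (L i) := by
  obtain ⟨a, ha, P, Q, R, hP, hQ, hR, dPQ, dPR, dQR, lP, lQ, lR⟩ := exists_tripod _ A (p 0) (p 1)
    (p 2) rfl hA (hp 0) (hp 1) (hp 2)
  refine ⟨a, ha, ![P, Q, R], ?_, ?_, ?_⟩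
  · intro i
    fin_cases i
    exacts [hP, hQ, hR]
  · intro i j hij
    fin_cases i <;> fin_cases j
    exacts [absurd rfl hij, dPQ, dPR, dPQ.symm, absurd rfl hij, dQR, dPR.symm, dQR.symm,
      absurd rfl hij]
  · intro i
    fin_cases i
    exacts [lP, lQ, lR]

/-- A `D₃` minor has a model in which the two vertices of degree three are single vertices. -/
theorem IsMinorOf.exists_model_D3 [Finite V] (h : IsMinorOf D3 G) :
    ∃ (a b : V) (C : Fin 3 → Set V), a ≠ b ∧ (∀ i, ConnSet G (C i)) ∧ (∀ i, a ∉ C i) ∧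
      (∀ i, b ∉ C i) ∧ (∀ i j x, x ∈ C i → x ∈ C j → i = j) ∧
      ∀ i, ∃ u ∈ C i, ∃ w ∈ C i, u ≠ w ∧ G.Adj a u ∧ G.Adj b w := by
  obtain ⟨f, -, hc, hd, he⟩ := h
  have hc' : ∀ w, ConnSet G (f w) := fun w => connSet_iff.2 (hc w)
  have hf : ∀ w w' x, x ∈ f w → x ∈ f w' → w = w' := by
    intro w w' x hx hx'
    by_contra hne
    exact Set.disjoint_left.1 (hd hne) hx hx'
  obtain ⟨m, n, hm0, hm1, hn0, hn1, hmn, hm, hn, e0, e1, e2⟩ : ∃ m n : Fin 3 → Fin 8,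
      (∀ i, 0 ≠ m i) ∧ (∀ i, 1 ≠ m i) ∧ (∀ i, 0 ≠ n i) ∧ (∀ i, 1 ≠ n i) ∧ (∀ i j, m i ≠ n j) ∧
      (∀ i j, m i = m j → i = j) ∧ (∀ i j, n i = n j → i = j) ∧ (∀ i, D3.Adj 0 (m i)) ∧
      (∀ i, D3.Adj 1 (n i)) ∧ ∀ i, D3.Adj (m i) (n i) := by
    refine ⟨![2, 4, 6], ![3, 5, 7], by decide, by decide, by decide, by decide, by decide,
      by decide, by decide, ?_, ?_, ?_⟩
    all_goals
      intro i
      fin_cases i <;> simp [D3]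
  choose p hp x hx hpx using fun i => he (e0 i)
  choose q hq y hy hqy using fun i => he (e1 i)
  choose x' hx' y' hy' hxy' using fun i => he (e2 i)
  obtain ⟨a, ha, L, hL, dL, lL⟩ := exists_tripod_fin (hc' 0) p hp
  obtain ⟨b, hb, M, hM, dM, lM⟩ := exists_tripod_fin (hc' 1) q hq
  have hL0 : ∀ i x, x ∈ L i → x ∈ f 0 := fun i x h => (hL i h).1
  have hM1 : ∀ i x, x ∈ M i → x ∈ f 1 := fun i x h => (hM i h).1
  have hdL : ∀ i j x, x ∈ L i → x ∈ L j → i = j := by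
    intro i j x hx hx'
    by_contra hne
    exact Set.disjoint_left.1 (dL hne) hx hx'
  have hdM : ∀ i j x, x ∈ M i → x ∈ M j → i = j := by
    intro i j x hx hx'
    by_contra hne
    exact Set.disjoint_left.1 (dM hne) hx hx'
  have hLf : ∀ i j x, x ∈ L i ∪ f (m i) → x ∈ M j ∪ f (n j) → False := by
    rintro i j x (h | h) (h' | h')
    · exact absurd (hf _ _ x (hL0 _ _ h) (hM1 _ _ h')) (by decide)
    · exact hn0 j (hf _ _ x (hL0 _ _ h) h')
    · exact hm1 i (hf _ _ x (hM1 _ _ h') h)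
    · exact hmn i j (hf _ _ x h h')
  refine ⟨a, b, fun i => (L i ∪ f (m i)) ∪ (M i ∪ f (n i)), ?_, ?_, ?_, ?_, ?_, ?_⟩
  · rintro rfl
    exact absurd (hf _ _ a ha hb) (by decide)
  · intro i
    exact ((lL i).union (hc' _) (hx i) (hpx i)).1.union_of_adj
      ((lM i).union (hc' _) (hy i) (hqy i)).1 (Or.inr (hx' i)) (Or.inr (hy' i)) (hxy' i)
  · rintro i ((h | h) | (h | h))
    · exact (hL i h).2 rfl
    · exact hm0 i (hf _ _ a ha h)
    · exact absurd (hf _ _ a ha (hM1 _ _ h)) (by decide)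
    · exact hn0 i (hf _ _ a ha h)
  · rintro i ((h | h) | (h | h))
    · exact absurd (hf _ _ b hb (hL0 _ _ h)) (by decide)
    · exact hm1 i (hf _ _ b hb h)
    · exact (hM i h).2 rfl
    · exact hn1 i (hf _ _ b hb h)
  · rintro i j z (h | h) (h' | h')
    · rcases h with h | h <;> rcases h' with h' | h'
      · exact hdL i j z h h'
      · exact absurd (hf _ _ z (hL0 _ _ h) h') (hm0 j)
      · exact absurd (hf _ _ z (hL0 _ _ h') h) (hm0 i)
      · exact hm i j (hf _ _ z h h')
    · exact (hLf _ _ z h h').elim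
    · exact (hLf _ _ z h' h).elim
    · rcases h with h | h <;> rcases h' with h' | h'
      · exact hdM i j z h h'
      · exact absurd (hf _ _ z (hM1 _ _ h) h') (hn1 j)
      · exact absurd (hf _ _ z (hM1 _ _ h') h) (hn1 i)
      · exact hn i j (hf _ _ z h h')
  · intro i
    obtain ⟨-, u, hu, hau⟩ := (lL i).union (hc' _) (hx i) (hpx i)
    obtain ⟨-, w, hw, hbw⟩ := (lM i).union (hc' _) (hy i) (hqy i)
    exact ⟨u, Or.inl hu, w, Or.inr hw, fun e => hLf i i u hu (e ▸ hw), hau, hbw⟩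

end Model

/-! ### Lower bounds from tree decompositions -/

theorem Set.false_of_four_mem {α : Type} [Finite α] {s : Set α} (hs : s.ncard ≤ 3) {a b c d : α}
    (ha : a ∈ s) (hb : b ∈ s) (hc : c ∈ s) (hd : d ∈ s) (hab : a ≠ b) (hac : a ≠ c) (had : a ≠ d)
    (hbc : b ≠ c) (hbd : b ≠ d) (hcd : c ≠ d) : False := by
  have h4 : ({a, b, c, d} : Set α).ncard = 4 := by
    rw [Set.ncard_insert_of_notMem (by simp [*]), Set.ncard_insert_of_notMem (by simp [*]),
      Set.ncard_pair hcd]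
  have : ({a, b, c, d} : Set α) ⊆ s := by
    rintro x (rfl | rfl | rfl | rfl) <;> assumption
  have := Set.ncard_le_ncard this
  omega

namespace TreeDecomp

variable {V : Type} {G : SimpleGraph V} (td : TreeDecomp G)

/-- The nodes whose bags meet a given set of vertices. -/
def nodes (C : Set V) : Set td.ι := {x | ∃ v ∈ C, v ∈ td.bag x}

variable {td} {C D : Set V}

theorem mem_nodes_singleton {v : V} {x : td.ι} : x ∈ td.nodes {v} ↔ v ∈ td.bag x := by
  simp [nodes]

theorem treeConvex_bag (v : V) : TreeConvex td.tree {x | v ∈ td.bag x} :=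
  (connSet_iff.2 (td.bag_conn v)).treeConvex

theorem exists_mem_of_separates (hC : ConnSet G C) {p p' : td.ι} (h : td.tree.Adj p p')
    (hx : ∃ x ∈ td.nodes C, x ∈ treeSide td.tree p p')
    (hy : ∃ y ∈ td.nodes C, y ∉ treeSide td.tree p p') :
    ∃ v ∈ C, v ∈ td.bag p ∧ v ∈ td.bag p' := by
  obtain ⟨x, ⟨u, hu, hux⟩, hxs⟩ := hx
  obtain ⟨y, ⟨v, hv, hvy⟩, hys⟩ := hy
  by_cases hvZ : ∃ x ∈ treeSide td.tree p p', v ∈ td.bag x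
  · obtain ⟨x', hx', hvx'⟩ := hvZ
    exact ⟨v, hv, treeConvex_bag v p p' h ⟨x', hvx', hx'⟩ ⟨y, hvy, hys⟩⟩
  · obtain ⟨a, ha, ⟨x', hx', hax'⟩, b, hb, hbZ, hab⟩ := hC.exists_exit
      {v | ∃ x ∈ treeSide td.tree p p', v ∈ td.bag x} hu ⟨x, hxs, hux⟩ hv hvZ
    obtain ⟨z, haz, hbz⟩ := td.bag_edge hab
    have hz : z ∉ treeSide td.tree p p' := fun hz => hbZ ⟨z, hz, hbz⟩
    exact ⟨a, ha, treeConvex_bag a p p' h ⟨x', hax', hx'⟩ ⟨z, haz, hz⟩⟩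

theorem treeConvex_nodes (hC : ConnSet G C) : TreeConvex td.tree (td.nodes C) := by
  intro p p' h hx hy
  obtain ⟨v, hv, hp, hp'⟩ := exists_mem_of_separates hC h hx hy
  exact ⟨⟨v, hv, hp⟩, v, hv, hp'⟩

theorem nodes_inter_nonempty {u v : V} (hu : u ∈ C) (hv : v ∈ D) (huv : G.Adj u v) :
    (td.nodes C ∩ td.nodes D).Nonempty := by
  obtain ⟨x, hux, hvx⟩ := td.bag_edge huv
  exact ⟨x, ⟨u, hu, hux⟩, v, hv, hvx⟩

/-- Three pairwise adjacent disjoint connected sets meet a common bag. -/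
theorem exists_bag_of_triangle {A B C : Set V} (hA : ConnSet G A) (hB : ConnSet G B)
    (hC : ConnSet G C) (hAB : ∃ u ∈ A, ∃ v ∈ B, G.Adj u v) (hAC : ∃ u ∈ A, ∃ v ∈ C, G.Adj u v)
    (hBC : ∃ u ∈ B, ∃ v ∈ C, G.Adj u v) :
    (td.nodes A ∩ td.nodes B ∩ td.nodes C).Nonempty := by
  obtain ⟨a, ha, b, hb, hab⟩ := hAB
  obtain ⟨a', ha', c, hc, hac⟩ := hAC
  obtain ⟨b', hb', c', hc', hbc⟩ := hBC
  exact TreeConvex.helly td.isTree (treeConvex_nodes hA) (treeConvex_nodes hB)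
    (treeConvex_nodes hC) (nodes_inter_nonempty ha hb hab) (nodes_inter_nonempty ha' hc hac)
    (nodes_inter_nonempty hb' hc' hbc)

theorem not_isMinorOf_K4 [Finite V] (h3 : ∀ x, (td.bag x).ncard ≤ 3) : ¬ IsMinorOf K4 G := by
  rintro ⟨f, -, hc, hd, he⟩
  have hc' : ∀ w, ConnSet G (f w) := fun w => connSet_iff.2 (hc w)
  have he' : ∀ i j, i ≠ j → ∃ u ∈ f i, ∃ v ∈ f j, G.Adj u v := fun i j hij => he hij
  have htri : ∀ i j k, i ≠ j → i ≠ k → j ≠ k →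
      (td.nodes (f i) ∩ td.nodes (f j) ∩ td.nodes (f k)).Nonempty := fun i j k hij hik hjk =>
    exists_bag_of_triangle (hc' i) (hc' j) (hc' k) (he' i j hij) (he' i k hik) (he' j k hjk)
  have hconv : ∀ i, TreeConvex td.tree (td.nodes (f i)) := fun i => treeConvex_nodes (hc' i)
  obtain ⟨p, ⟨⟨⟨v0, h0, hv0⟩, v1, h1, hv1⟩, -, v2, h2, hv2⟩, -, v3, h3', hv3⟩ :=
    TreeConvex.helly td.isTree ((hconv 0).inter (hconv 1)) ((hconv 0).inter (hconv 2))
      ((hconv 0).inter (hconv 3))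
      ((htri 0 1 2 (by decide) (by decide) (by decide)).mono fun x hx => ⟨hx.1, hx.1.1, hx.2⟩)
      ((htri 0 1 3 (by decide) (by decide) (by decide)).mono fun x hx => ⟨hx.1, hx.1.1, hx.2⟩)
      ((htri 0 2 3 (by decide) (by decide) (by decide)).mono fun x hx => ⟨hx.1, hx.1.1, hx.2⟩)
  have hne : ∀ i j, i ≠ j → ∀ {u v}, u ∈ f i → v ∈ f j → u ≠ v := fun i j hij u v hu hv =>
    (hd hij).ne_of_mem hu hv
  exact Set.false_of_four_mem (h3 p) hv0 hv1 hv2 hv3 (hne 0 1 (by decide) h0 h1)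
    (hne 0 2 (by decide) h0 h2) (hne 0 3 (by decide) h0 h3') (hne 1 2 (by decide) h1 h2)
    (hne 1 3 (by decide) h1 h3') (hne 2 3 (by decide) h2 h3')

theorem exists_three_le_ncard_bag [Finite V] (td : TreeDecomp G) (hV : 3 ≤ Nat.card V)
    (h2 : ∀ v, ConnSet G {x | x ≠ v}) : ∃ x, 3 ≤ (td.bag x).ncard := by
  have hV' : 2 < (Set.univ : Set V).ncard := by rw [Set.ncard_univ]; exact hV
  obtain ⟨p, -, q, -, r, -, hpq, hpr, hqr⟩ := (Set.two_lt_ncard (Set.toFinite _)).1 hV'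
  obtain ⟨s, -, -, t, -, hne, hst⟩ := (h2 r).exists_exit {p} (x := p) (y := q) hpr rfl hqr hpq.symm
  have hst' : s ≠ t := hst.ne
  obtain ⟨w, hws, hwt⟩ : ∃ w, w ≠ s ∧ w ≠ t := by
    by_contra! hc
    have : (Set.univ : Set V) ⊆ {s, t} := fun w _ => by
      by_cases h : w = s
      · exact Or.inl h
      · exact Or.inr (hc w h)
    have := Set.ncard_le_ncard this
    rw [Set.ncard_pair hst'] at this
    omega
  have hL : IsLobe G s t (compIn G {v | v ≠ s ∧ v ≠ t} w) := isLobe_compIn hws hwt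
  obtain ⟨u, hu, hsu⟩ := hL.exists_adj_left h2 hst'
  obtain ⟨u', hu', htu'⟩ := hL.exists_adj_right h2 hst'
  obtain ⟨x, ⟨hs, ht⟩, v, hv, hvx⟩ := exists_bag_of_triangle (td := td) (ConnSet.singleton s)
    (ConnSet.singleton t) hL.conn ⟨s, rfl, t, rfl, hst⟩ ⟨s, rfl, u, hu, hsu⟩ ⟨t, rfl, u', hu', htu'⟩
  rw [mem_nodes_singleton] at hs ht
  refine ⟨x, (Set.two_lt_ncard (Set.toFinite _)).2 ⟨s, hs, t, ht, v, hvx, hst', ?_, ?_⟩⟩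
  · rintro rfl
    exact hL.left_notMem hv
  · rintro rfl
    exact hL.right_notMem hv

end TreeDecomp

namespace SpaghettiTD

variable {V : Type} {G : SimpleGraph V} {td : SpaghettiTD G}

open TreeDecomp

/-- If the nodes of `K` leave those of `b` within those of `a`, then they contain an end of the path
of the nodes common to `a` and `b`. -/
theorem exists_end_of_leaves {a b : V} {K : Set V} (hK : ConnSet G K) {p x : td.ι}
    (hpa : a ∈ td.bag p) (hpb : b ∈ td.bag p) (hpK : p ∈ td.nodes K) (hxa : a ∈ td.bag x)
    (hxb : b ∉ td.bag x) (hxK : x ∈ td.nodes K) :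
    ∃ z ∈ td.nodes K, a ∈ td.bag z ∧ b ∈ td.bag z ∧
      {y | (a ∈ td.bag y ∧ b ∈ td.bag y) ∧ td.tree.Adj z y}.ncard ≤ 1 := by
  obtain ⟨z, z', hzz, hzb, hz'b, hxs, hbs⟩ :=
    (treeConvex_bag (td := td.toTreeDecomp) b).exists_exit_edge td.isTree hpb hxb
  obtain ⟨hza, hz'a⟩ := treeConvex_bag (td := td.toTreeDecomp) a z z' hzz ⟨p, hpa, hbs hpb⟩
    ⟨x, hxa, hxs⟩
  obtain ⟨hzK, -⟩ := treeConvex_nodes (td := td.toTreeDecomp) hK z z' hzz ⟨p, hpK, hbs hpb⟩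
    ⟨x, hxK, hxs⟩
  refine ⟨z, hzK, hza, hzb, ?_⟩
  have := td.finι
  have h2 := (td.bag_path a).2 z hza
  have hsub : insert z' {y | (a ∈ td.bag y ∧ b ∈ td.bag y) ∧ td.tree.Adj z y} ⊆
      {y | y ∈ {x | a ∈ td.bag x} ∧ td.tree.Adj z y} := by
    rintro y (rfl | hy)
    exacts [⟨hz'a, hzz⟩, ⟨hy.1.1, hy.2⟩]
  have h3 := Set.ncard_le_ncard hsub
  rw [Set.ncard_insert_of_notMem (fun h => hz'b h.1.2)] at h3
  omega

/-- A vertex of a connected set in a bag with `a` and `b` is in every such bag met by the set, as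
long as bags have at most three vertices. -/
theorem mem_bag_of_mem_bag [Finite V] (h3 : ∀ x, (td.bag x).ncard ≤ 3) {a b : V} {K : Set V}
    (hab : a ≠ b) (hK : ConnSet G K) (ha : a ∉ K) (hb : b ∉ K) {u : V} (hu : u ∈ K) {x y : td.ι}
    (hxa : a ∈ td.bag x) (hxb : b ∈ td.bag x) (hux : u ∈ td.bag x) (hya : a ∈ td.bag y)
    (hyb : b ∈ td.bag y) (hyK : y ∈ td.nodes K) : u ∈ td.bag y := by
  have huniq : ∀ {z : td.ι} {v v' : V}, a ∈ td.bag z → b ∈ td.bag z → v ∈ td.bag z →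
      v' ∈ td.bag z → v ∈ K → v' ∈ K → v = v' := by
    intro z v v' hza hzb hv hv' hvK hv'K
    by_contra hne
    exact Set.false_of_four_mem (h3 z) hza hzb hv hv' hab (fun e => ha (e ▸ hvK))
      (fun e => ha (e ▸ hv'K)) (fun e => hb (e ▸ hvK)) (fun e => hb (e ▸ hv'K)) hne
  have hS : ConnSet td.tree (({x | a ∈ td.bag x} ∩ {x | b ∈ td.bag x}) ∩ td.nodes K) :=
    TreeConvex.connSet td.isTree
      (((treeConvex_bag (td := td.toTreeDecomp) a).inter (treeConvex_bag b)).inter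
        (treeConvex_nodes hK)) ⟨x, ⟨hxa, hxb⟩, u, hu, hux⟩
  refine hS.2 {z | u ∈ td.bag z} ⟨x, ⟨⟨hxa, hxb⟩, u, hu, hux⟩, hux⟩ ?_ ⟨⟨hya, hyb⟩, hyK⟩
  rintro z ⟨⟨hza, hzb⟩, hzK⟩ huz z' ⟨-, hz'K⟩ hzz
  obtain ⟨v, hv, hvz, hvz'⟩ := exists_mem_of_separates hK hzz ⟨z, hzK, left_mem_treeSide _ _⟩
    ⟨z', hz'K, right_notMem_treeSide td.isTree.isAcyclic hzz⟩
  rw [Set.mem_ofPred_eq, huniq hza hzb huz hvz hu hv]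
  exact hvz'

theorem exists_end [Finite V] (h3 : ∀ x, (td.bag x).ncard ≤ 3) {a b : V} {K : Set V}
    (hab : a ≠ b) (hne : ∃ p, a ∈ td.bag p ∧ b ∈ td.bag p) (hK : ConnSet G K) (ha : a ∉ K)
    (hb : b ∉ K) {u w : V} (hu : u ∈ K) (hw : w ∈ K) (huw : u ≠ w) (hau : G.Adj a u)
    (hbw : G.Adj b w) :
    ∃ z ∈ td.nodes K, a ∈ td.bag z ∧ b ∈ td.bag z ∧
      {y | (a ∈ td.bag y ∧ b ∈ td.bag y) ∧ td.tree.Adj z y}.ncard ≤ 1 := by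
  obtain ⟨x, hax, hux⟩ := td.bag_edge hau
  obtain ⟨y, hby, hwy⟩ := td.bag_edge hbw
  obtain ⟨p, ⟨hpa, hpb⟩, hpK⟩ := TreeConvex.helly td.isTree
    (treeConvex_bag (td := td.toTreeDecomp) a) (treeConvex_bag b) (treeConvex_nodes hK) hne
    ⟨x, hax, u, hu, hux⟩ ⟨y, hby, w, hw, hwy⟩
  by_cases hbx : b ∈ td.bag x
  · by_cases hay : a ∈ td.bag y
    · have := mem_bag_of_mem_bag h3 hab hK ha hb hu hax hbx hux hay hby ⟨w, hw, hwy⟩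
      refine (Set.false_of_four_mem (h3 y) hay hby this hwy hab ?_ ?_ ?_ ?_ huw).elim
      all_goals rintro rfl; contradiction
    · obtain ⟨z, hzK, hzb, hza, hz⟩ := exists_end_of_leaves hK hpb hpa hpK hby hay ⟨w, hw, hwy⟩
      refine ⟨z, hzK, hza, hzb, ?_⟩
      simpa only [and_comm (a := a ∈ td.bag _)] using hz
  · exact exists_end_of_leaves hK hpa hpb hpK hax hbx ⟨u, hu, hux⟩

theorem not_isMinorOf_D3 [Finite V] (h3 : ∀ x, (td.bag x).ncard ≤ 3) : ¬ IsMinorOf D3 G := by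
  intro h
  obtain ⟨a, b, C, hab, hC, haC, hbC, hdisj, hadj⟩ := h.exists_model_D3
  have hne : ∃ p, a ∈ td.bag p ∧ b ∈ td.bag p := by
    by_contra! hno
    obtain ⟨x, hx⟩ := td.bag_cover a
    obtain ⟨y, hy⟩ := td.bag_cover b
    obtain ⟨z, z', hzz, hza, -, hys, has⟩ :=
      (treeConvex_bag (td := td.toTreeDecomp) a).exists_exit_edge td.isTree hx
        (fun hay : a ∈ td.bag y => hno y hay hy)
    have hmem : ∀ i, z ∈ td.nodes (C i) := by
      intro i
      obtain ⟨u, hu, w, hw, -, hau, hbw⟩ := hadj i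
      obtain ⟨p, hap, hup⟩ := td.bag_edge hau
      obtain ⟨q, hbq, hwq⟩ := td.bag_edge hbw
      refine (treeConvex_nodes (td := td.toTreeDecomp) (hC i) z z' hzz
        ⟨p, ⟨u, hu, hup⟩, has hap⟩ ⟨q, ⟨w, hw, hwq⟩, fun hq => ?_⟩).1
      exact hno z hza (treeConvex_bag (td := td.toTreeDecomp) b z z' hzz ⟨q, hbq, hq⟩
        ⟨y, hy, hys⟩).1
    choose c hc hcz using hmem
    refine Set.false_of_four_mem (h3 z) hza (hcz 0) (hcz 1) (hcz 2) (fun e => haC 0 (e ▸ hc 0))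
      (fun e => haC 1 (e ▸ hc 1)) (fun e => haC 2 (e ▸ hc 2)) ?_ ?_ ?_ <;> intro e
    · exact absurd (hdisj 0 1 _ (hc 0) (e ▸ hc 1)) (by decide)
    · exact absurd (hdisj 0 2 _ (hc 0) (e ▸ hc 2)) (by decide)
    · exact absurd (hdisj 1 2 _ (hc 1) (e ▸ hc 2)) (by decide)
  have hend : ∀ i, ∃ z ∈ td.nodes (C i), a ∈ td.bag z ∧ b ∈ td.bag z ∧
      {y | (a ∈ td.bag y ∧ b ∈ td.bag y) ∧ td.tree.Adj z y}.ncard ≤ 1 := by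
    intro i
    obtain ⟨u, hu, w, hw, huw, hau, hbw⟩ := hadj i
    exact exists_end h3 hab hne (hC i) (haC i) (hbC i) hu hw huw hau hbw
  choose z hzC hza hzb hz using hend
  have hconn := connSet_iff.1 (TreeConvex.connSet td.isTree
    ((treeConvex_bag (td := td.toTreeDecomp) a).inter (treeConvex_bag b)) hne)
  have := td.finι
  have hcard : ∀ x : ↥({x | a ∈ td.bag x} ∩ {x | b ∈ td.bag x}),
      ((td.tree.induce ({x | a ∈ td.bag x} ∩ {x | b ∈ td.bag x})).neighborSet x).ncard ≤
        {y | (a ∈ td.bag y ∧ b ∈ td.bag y) ∧ td.tree.Adj x y}.ncard := by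
    intro x
    rw [← Set.ncard_image_of_injective _ Subtype.val_injective]
    refine Set.ncard_le_ncard ?_
    rintro _ ⟨y, hy, rfl⟩
    exact ⟨y.2, hy⟩
  refine hconn.false_of_three_ends (fun x => (hcard x).trans (le_trans ?_
    ((td.bag_path a).2 x x.2.1))) (fun i => ⟨z i, hza i, hzb i⟩) ?_ fun i => (hcard _).trans (hz i)
  · exact Set.ncard_le_ncard fun y hy => ⟨hy.1.1, hy.2⟩
  · intro i j hij
    have hij' : z i = z j := congrArg Subtype.val hij
    obtain ⟨u, hu, huz⟩ := hzC i
    obtain ⟨v, hv, hvz⟩ := hzC j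
    rw [← hij'] at hvz
    by_contra hne'
    exact Set.false_of_four_mem (h3 (z i)) (hza i) (hzb i) huz hvz hab
      (fun e => haC i (e ▸ hu)) (fun e => haC j (e ▸ hv)) (fun e => hbC i (e ▸ hu))
      (fun e => hbC j (e ▸ hv)) fun e => hne' (hdisj i j u hu (e ▸ hv))

end SpaghettiTD

/-- A 2-connected finite simple graph has spaghetti treewidth equal to two iff it
has no minor isomorphic to `K₄` or to `D₃`. -/
theorem statement2 {V : Type} [Fintype V] (G : SimpleGraph V) (hG : TwoConnected G) :
    sptw G = 2 ↔ (¬ IsMinorOf K4 G ∧ ¬ IsMinorOf D3 G) := by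
  have h2 : ∀ v, ConnSet G {x | x ≠ v} := fun v => connSet_iff.2 (hG.2 v)
  constructor
  · intro h
    obtain ⟨td, htd⟩ : 2 ∈ {k | ∃ td : SpaghettiTD G, ∀ x, (td.bag x).ncard ≤ k + 1} := by
      have hne : {k | ∃ td : SpaghettiTD G, ∀ x, (td.bag x).ncard ≤ k + 1}.Nonempty :=
        Nat.nonempty_of_sInf_eq_succ (k := 1) h
      have := Nat.sInf_mem hne
      rwa [show sInf _ = 2 from h] at this
    exact ⟨TreeDecomp.not_isMinorOf_K4 (td := td.toTreeDecomp) htd,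
      SpaghettiTD.not_isMinorOf_D3 htd⟩
  · rintro ⟨hK4, hD3⟩
    refine le_antisymm (Nat.sInf_le (exists_spaghettiTD hK4 hD3 h2)) (le_csInf
      ⟨2, exists_spaghettiTD hK4 hD3 h2⟩ ?_)
    rintro k ⟨td, htd⟩
    obtain ⟨x, hx⟩ := td.toTreeDecomp.exists_three_le_ncard_bag hG.1 h2
    have := htd x
    omega
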